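/- arXiv:1105.1979 — 5 statements merged into one kernel-verified Lean document; each statement's English description precedes it below -/
import Mathlib

section
/- Let (X,d) be a compact metric space with basepoint x∞ and (Y,d') a compact metric space with basepoint y∞, and let f : X → Y be a continuous surjection with f(x∞) = y∞. Let ε > 0, δ > 0, and let a₁,…,a_m : X → ℂ be continuous functions with a_i(x∞) = 0 such that d(x,x') < δ implies |a_i(x) − a_i(x')| < ε for all i. Suppose there exists a finite open cover V₁,…,V_p of Y such that each preimage f⁻¹(V_j) has diameter < δ. Then there exist continuous functions b₁,…,b_m : Y → ℂ with b_i(y∞) = 0 such that sup_{x∈X} |a_i(x) − b_i(f(x))| ≤ ε for every i. (This is the substance of the implication (a) ⇒ (b) of the paper's Proposition: if a pointed compact metric space X is 𝒫-like, then C₀(X,x∞) is approximated by subalgebras C₀(Y,y∞) with (Y,y∞) ∈ 𝒫.) -/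
/-- If `(X, x∞)` is mapped onto `(Y, y∞)` by a pointed continuous surjection whose point
preimages are uniformly small (as witnessed by an open cover of `Y` with `δ`-small preimages),
then any finite family of basepoint-vanishing continuous functions on `X` with modulus of
continuity `(δ, ε)` can be `ε`-approximated (in sup-norm) by functions pulled back from
`C₀(Y, y∞)`. -/
theorem pLike_implies_approximation_by_subalgebras
    {X Y : Type u} [MetricSpace X] [CompactSpace X] [MetricSpace Y] [CompactSpace Y]
    (xinf : X) (yinf : Y) (f : C(X, Y)) (hf_surj : Function.Surjective f)
    (hf_pt : f xinf = yinf)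
    (ε δ : ℝ) (hε : 0 < ε) (hδ : 0 < δ)
    (m : ℕ) (a : Fin m → C(X, ℂ)) (ha0 : ∀ i, a i xinf = 0)
    (hmod : ∀ (i : Fin m) (x x' : X), dist x x' < δ → ‖a i x - a i x'‖ < ε)
    (p : ℕ) (V : Fin p → Set Y) (hVopen : ∀ j, IsOpen (V j))
    (hVcover : (⋃ j, V j) = Set.univ)
    (hVdiam : ∀ j, Metric.diam (f ⁻¹' V j) < δ) :
    ∃ b : Fin m → C(Y, ℂ), (∀ i, b i yinf = 0) ∧
      ∀ (i : Fin m) (x : X), ‖a i x - b i (f x)‖ ≤ ε := by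
  have local_const (i : Fin m) (x₀ : X) (h₀ : f x₀ = yinf → a i x₀ = 0) :
      ∀ᶠ y in nhds (f x₀), a i x₀ ∈
        {c : ℂ | y = yinf → c = 0} ∩ ⋂ x ∈ f ⁻¹' {y}, Metric.closedBall (a i x) ε := by
    obtain ⟨j, hj⟩ := Set.mem_iUnion.mp (hVcover ▸ Set.mem_univ (f x₀))
    have hbase : ∀ᶠ y in nhds (f x₀), y = yinf → a i x₀ = 0 := by
      by_cases h : f x₀ = yinf
      · exact .of_forall fun _ _ => h₀ h
      · filter_upwards [isOpen_ne.mem_nhds h] with y hy using fun h' => absurd h' hy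
    filter_upwards [(hVopen j).mem_nhds hj, hbase] with y hy hy₀
    refine ⟨hy₀, Set.mem_iInter₂.mpr fun x hx => ?_⟩
    rw [Metric.mem_closedBall, dist_eq_norm]
    have hxV : x ∈ f ⁻¹' V j := by
      rw [Set.mem_preimage, show f x = y from hx]
      exact hy
    have hxV₀ : x₀ ∈ f ⁻¹' V j := hj
    have hdist := Metric.dist_le_diam_of_mem Metric.isBounded_of_compactSpace hxV₀ hxV
    exact (hmod i x₀ x (hdist.trans_lt (hVdiam j))).le
  have approx (i : Fin m) : ∃ g : C(Y, ℂ), ∀ y, g y ∈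
      {c : ℂ | y = yinf → c = 0} ∩ ⋂ x ∈ f ⁻¹' {y}, Metric.closedBall (a i x) ε := by
    refine exists_continuous_forall_mem_convex_of_local_const (fun y => ?_) fun y => ?_
    · refine Convex.inter ?_ (convex_iInter₂ fun x _ => convex_closedBall _ _)
      intro c hc c' hc' s t _ _ _ hy
      simp [hc hy, hc' hy]
    · by_cases hy : y = yinf
      · subst hy
        exact ⟨_, hf_pt ▸ local_const i xinf fun _ => ha0 i⟩
      · obtain ⟨x₀, rfl⟩ := hf_surj y
        exact ⟨_, local_const i x₀ fun h => absurd h hy⟩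
  choose b hb using approx
  refine ⟨b, fun i => (hb i yinf).1 rfl, fun i x => ?_⟩
  have := Set.mem_iInter₂.mp (hb i (f x)).2 x rfl
  rwa [Metric.mem_closedBall, dist_comm, dist_eq_norm] at this
end

section
/- Let (X,d) be a compact metric space with basepoint x∞ and let U₁,…,U_n be a finite open cover of X. Then there exist finitely many continuous functions a₁,…,a_m : X → ℂ with a_i(x∞) = 0 such that the following holds: for every compact metric space Y with basepoint y∞ and every continuous surjection f : X → Y with f(x∞) = y∞, if for each i there exists a continuous b_i : Y → ℂ with b_i(y∞) = 0 and sup_{x∈X} |a_i(x) − b_i(f(x))| < 1/2, then there exists a finite open cover W₁,…,W_p of Y such that each preimage f⁻¹(W_j) is contained in some member U_l of the given cover. (This is the substance of the implication (b) ⇒ (a) of the paper's Proposition: if C₀(X,x∞) is approximated by subalgebras of the form C₀(Y,y∞), then (X,x∞) is 𝒫-like with respect to the occurring spaces (Y,y∞).) -/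
/-- On a compact metric space, the scaled distances to the points of a finite net, normalised to
vanish at a basepoint, separate points at distance at least `δ` by at least `1`. -/
lemma exists_finite_family_separating_far_points {X : Type*} [MetricSpace X] [CompactSpace X]
    (xinf : X) {δ : ℝ} (hδ : 0 < δ) :
    ∃ (m : ℕ) (a : Fin m → C(X, ℂ)), (∀ i, a i xinf = 0) ∧
      ∀ x x' : X, δ ≤ dist x x' → ∃ i, 1 ≤ ‖a i x - a i x'‖ := by
  obtain ⟨t, ht, hcover⟩ := Metric.totallyBounded_iff.mp
    (isCompact_univ (X := X)).totallyBounded (δ / 4) (by positivity)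
  obtain ⟨m, c, -, rfl⟩ := ht.fin_param
  refine ⟨m, fun i ↦ ⟨fun x ↦ ((2 / δ * (dist x (c i) - dist xinf (c i)) : ℝ) : ℂ), by fun_prop⟩,
    fun i ↦ by simp, fun x x' hxx' ↦ ?_⟩
  obtain ⟨i, hi⟩ : ∃ i, dist x (c i) < δ / 4 := by
    simpa using hcover (Set.mem_univ x)
  refine ⟨i, ?_⟩
  have hfar : δ / 2 ≤ dist x' (c i) - dist x (c i) := by
    linarith [dist_triangle_right x x' (c i)]
  rw [ContinuousMap.coe_mk, ← Complex.ofReal_sub, Complex.norm_real, Real.norm_eq_abs, abs_sub_comm]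
  calc 1 = 2 / δ * (δ / 2) := by field_simp
    _ ≤ 2 / δ * (dist x' (c i) - dist x (c i)) := by gcongr
    _ = 2 / δ * (dist x' (c i) - dist xinf (c i)) - 2 / δ * (dist x (c i) - dist xinf (c i)) := by
      ring
    _ ≤ _ := le_abs_self _

/-- Given a finite open cover `U₁, …, U_n` of a pointed compact metric space `(X, x∞)`, there
are finitely many basepoint-vanishing continuous functions `a₁, …, a_m` on `X` such that:
whenever `f : (X, x∞) → (Y, y∞)` is a pointed continuous surjection onto a pointed compact
metric space such that each `a_i` is approximated up to `1/2` in sup-norm by a function pulled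
back from `C₀(Y, y∞)`, there is a finite open cover `W₁, …, W_p` of `Y` whose preimages under
`f` refine the given cover. -/
theorem approximation_by_subalgebras_implies_pLike
    {X : Type u} [MetricSpace X] [CompactSpace X] (xinf : X)
    (n : ℕ) (U : Fin n → Set X) (hUopen : ∀ l, IsOpen (U l))
    (hUcover : (⋃ l, U l) = Set.univ) :
    ∃ (m : ℕ) (a : Fin m → C(X, ℂ)), (∀ i, a i xinf = 0) ∧
      ∀ (Y : Type u) [MetricSpace Y] [CompactSpace Y], ∀ (yinf : Y) (f : C(X, Y)),
        Function.Surjective f → f xinf = yinf →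
        (∀ i, ∃ b : C(Y, ℂ), b yinf = 0 ∧ ∀ x : X, ‖a i x - b (f x)‖ < 1 / 2) →
        ∃ (p : ℕ) (W : Fin p → Set Y), (∀ j, IsOpen (W j)) ∧ (⋃ j, W j) = Set.univ ∧
          ∀ j, ∃ l, f ⁻¹' W j ⊆ U l := by
  obtain ⟨δ, hδ, hball⟩ := lebesgue_number_lemma_of_metric isCompact_univ hUopen hUcover.ge
  obtain ⟨m, a, ha0, ha⟩ := exists_finite_family_separating_far_points xinf hδ
  refine ⟨m, a, ha0, fun Y _ _ yinf f hf _ happrox ↦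
    ⟨n, fun l ↦ (f '' (U l)ᶜ)ᶜ, fun l ↦ ?_, ?_, fun l ↦ ⟨l, fun x hx ↦ ?_⟩⟩⟩
  · exact (f.continuous.isClosedMap _ (hUopen l).isClosed_compl).isOpen_compl
  · refine Set.eq_univ_of_forall fun y ↦ ?_
    obtain ⟨x, rfl⟩ := hf y
    obtain ⟨l, hl⟩ := hball x (Set.mem_univ x)
    refine Set.mem_iUnion.mpr ⟨l, ?_⟩
    rintro ⟨x', hx', hfx⟩
    obtain ⟨i, hi⟩ := ha x' x (not_lt.mp fun h ↦ hx' (hl h))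
    obtain ⟨b, -, hb⟩ := happrox i
    have h₁ := hb x'
    have h₂ := hb x
    rw [hfx] at h₁
    rw [norm_sub_rev] at h₂
    linarith [norm_sub_le_norm_sub_add_norm_sub (a i x') (b (f x)) (a i x)]
  · by_contra hxU
    exact hx ⟨x, hxU, rfl⟩
end

section
/- Let φ : A → B be a weakly semiprojective *-homomorphism between C*-algebras, let (C_k, γ_k) be an inductive system of C*-algebras with inductive limit C and limit maps γ_{∞,k} : C_k → C, and let σ : B → C be a *-homomorphism. Then for every ε > 0 and every finite subset F ⊆ A there exist an index k and a *-homomorphism ψ : A → C_k such that ‖γ_{∞,k}(ψ(x)) − σ(φ(x))‖ < ε for all x ∈ F. -/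
open Filter Topology Set

noncomputable section

universe u v

/-- The iterated connecting morphisms `γ_{k+n,k} : A_k → A_{k+n}` of an inductive system. -/
def iterHom {A : ℕ → Type u} [∀ k, NonUnitalCStarAlgebra (A k)]
    (γ : ∀ k, A k →⋆ₙₐ[ℂ] A (k + 1)) : ∀ k n : ℕ, A k →⋆ₙₐ[ℂ] A (k + n)
  | _, 0 => NonUnitalStarAlgHom.id ℂ _
  | k, n + 1 => (γ (k + n)).comp (iterHom γ k n)

/-- `(L, μ)` is the inductive limit of the inductive system `(A, γ)` of C*-algebras. -/
structure IsInductiveLimit {A : ℕ → Type u} [∀ k, NonUnitalCStarAlgebra (A k)]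
    (γ : ∀ k, A k →⋆ₙₐ[ℂ] A (k + 1)) (L : Type v) [NonUnitalCStarAlgebra L]
    (μ : ∀ k, A k →⋆ₙₐ[ℂ] L) : Prop where
  compat : ∀ k, (μ (k + 1)).comp (γ k) = μ k
  dense_union : Dense (⋃ k, Set.range (μ k))
  norm_tendsto : ∀ (k : ℕ) (a : A k),
    Tendsto (fun n => ‖iterHom γ k n a‖) atTop (𝓝 ‖μ k a‖)

/-- Two *-homomorphisms are homotopic if they are connected by a path of *-homomorphisms,
i.e. by a *-homomorphism into `C([0,1], B)`. -/
def Homotopic {A : Type u} {B : Type v} [NonUnitalCStarAlgebra A] [NonUnitalCStarAlgebra B]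
    (φ ψ : A →⋆ₙₐ[ℂ] B) : Prop :=
  ∃ H : A →⋆ₙₐ[ℂ] C(unitInterval, B), (∀ a, H a 0 = φ a) ∧ (∀ a, H a 1 = ψ a)

/-- A *-homomorphism is null-homotopic if it is homotopic to the zero morphism. -/
def NullHomotopic {A : Type u} {B : Type v} [NonUnitalCStarAlgebra A] [NonUnitalCStarAlgebra B]
    (φ : A →⋆ₙₐ[ℂ] B) : Prop :=
  Homotopic φ 0

/-- A C*-algebra is contractible if its identity is null-homotopic. -/
def Contractible (A : Type u) [NonUnitalCStarAlgebra A] : Prop :=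
  NullHomotopic (NonUnitalStarAlgHom.id ℂ A)

/-- A projective *-homomorphism between C*-algebras. -/
def IsProjectiveMorphism {A B : Type u} [NonUnitalCStarAlgebra A] [NonUnitalCStarAlgebra B]
    (φ : A →⋆ₙₐ[ℂ] B) : Prop :=
  ∀ (C D : Type u) [NonUnitalCStarAlgebra C] [NonUnitalCStarAlgebra D]
    (π : C →⋆ₙₐ[ℂ] D), Function.Surjective π → ∀ σ : B →⋆ₙₐ[ℂ] D,
    ∃ ψ : A →⋆ₙₐ[ℂ] C, π.comp ψ = σ.comp φ

/-- A projective C*-algebra. -/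
def IsProjective (A : Type u) [NonUnitalCStarAlgebra A] : Prop :=
  IsProjectiveMorphism (NonUnitalStarAlgHom.id ℂ A)

/-- A semiprojective *-homomorphism between C*-algebras. -/
def IsSemiprojectiveMorphism {A B : Type u} [NonUnitalCStarAlgebra A] [NonUnitalCStarAlgebra B]
    (φ : A →⋆ₙₐ[ℂ] B) : Prop :=
  ∀ (C : ℕ → Type u) [∀ k, NonUnitalCStarAlgebra (C k)]
    (δ : ∀ k, C k →⋆ₙₐ[ℂ] C (k + 1)), (∀ k, Function.Surjective (δ k)) →
    ∀ (L : Type u) [NonUnitalCStarAlgebra L] (μ : ∀ k, C k →⋆ₙₐ[ℂ] L),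
    IsInductiveLimit δ L μ → ∀ σ : B →⋆ₙₐ[ℂ] L,
    ∃ (k : ℕ) (ψ : A →⋆ₙₐ[ℂ] C k), (μ k).comp ψ = σ.comp φ

/-- A semiprojective C*-algebra. -/
def IsSemiprojective (A : Type u) [NonUnitalCStarAlgebra A] : Prop :=
  IsSemiprojectiveMorphism (NonUnitalStarAlgHom.id ℂ A)

/-- A weakly semiprojective *-homomorphism between C*-algebras. -/
def IsWeaklySemiprojectiveMorphism {A B : Type u} [NonUnitalCStarAlgebra A]
    [NonUnitalCStarAlgebra B] (φ : A →⋆ₙₐ[ℂ] B) : Prop :=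
  ∀ (C : ℕ → Type u) [∀ k, NonUnitalCStarAlgebra (C k)]
    (δ : ∀ k, C k →⋆ₙₐ[ℂ] C (k + 1)), (∀ k, Function.Surjective (δ k)) →
    ∀ (L : Type u) [NonUnitalCStarAlgebra L] (μ : ∀ k, C k →⋆ₙₐ[ℂ] L),
    IsInductiveLimit δ L μ → ∀ σ : B →⋆ₙₐ[ℂ] L,
    ∀ ε : ℝ, 0 < ε → ∀ F : Finset A,
    ∃ (k : ℕ) (ψ : A →⋆ₙₐ[ℂ] C k), ∀ x ∈ F, ‖μ k (ψ x) - σ (φ x)‖ < ε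

/-- A weakly semiprojective C*-algebra. -/
def IsWeaklySemiprojective (A : Type u) [NonUnitalCStarAlgebra A] : Prop :=
  IsWeaklySemiprojectiveMorphism (NonUnitalStarAlgHom.id ℂ A)

/-- A weakly projective C*-algebra. -/
def IsWeaklyProjective (A : Type u) [NonUnitalCStarAlgebra A] : Prop :=
  ∀ (C D : Type u) [NonUnitalCStarAlgebra C] [NonUnitalCStarAlgebra D]
    (π : C →⋆ₙₐ[ℂ] D), Function.Surjective π → ∀ σ : A →⋆ₙₐ[ℂ] D,
    ∀ ε : ℝ, 0 < ε → ∀ F : Finset A,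
    ∃ ψ : A →⋆ₙₐ[ℂ] C, ∀ x ∈ F, ‖π (ψ x) - σ x‖ < ε

/-- `F ⊂_ε G` : every element of `F` is within `ε` of some element of `G`. -/
def EpsContained {A : Type*} [NonUnitalCStarAlgebra A] (ε : ℝ) (F G : Set A) : Prop :=
  ∀ x ∈ F, ∃ y ∈ G, ‖x - y‖ < ε

/-- A subset of a C*-algebra which is a sub-C*-algebra. -/
def IsCStarSubset {A : Type*} [NonUnitalCStarAlgebra A] (S : Set A) : Prop :=
  IsClosed S ∧ (0 : A) ∈ S ∧ (∀ x ∈ S, ∀ y ∈ S, x + y ∈ S) ∧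
    (∀ x ∈ S, ∀ y ∈ S, x * y ∈ S) ∧ (∀ (c : ℂ), ∀ x ∈ S, c • x ∈ S) ∧ ∀ x ∈ S, star x ∈ S

/-- A C*-algebra is finitely generated if some finite subset is contained in no proper
sub-C*-algebra. -/
def IsFinitelyGeneratedCStar (A : Type*) [NonUnitalCStarAlgebra A] : Prop :=
  ∃ S : Finset A, ∀ T : Set A, IsCStarSubset T → ↑S ⊆ T → T = Set.univ

end
noncomputable section
universe w

/-- A bundled inductive system of C*-algebras. -/
structure CStarInductiveSystem : Type (w + 1) where
  X : ℕ → Type w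
  inst : ∀ k, NonUnitalCStarAlgebra (X k)
  conn : ∀ k, X k →⋆ₙₐ[ℂ] X (k + 1)

attribute [instance] CStarInductiveSystem.inst

/-- `A` is (isomorphic to) an inductive limit of projective C*-algebras,
i.e. `A` has trivial shape. -/
def IsInductiveLimitOfProjectives (A : Type w) [NonUnitalCStarAlgebra A] : Prop :=
  ∃ (S : CStarInductiveSystem.{w}) (μ : ∀ k, S.X k →⋆ₙₐ[ℂ] A),
    IsInductiveLimit S.conn A μ ∧ ∀ k, IsProjective (S.X k)

end

open scoped ENNReal CStarAlgebra

/-- The *-homomorphism on bounded sequences which replaces the first `k` entries by zero. -/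
noncomputable def truncation (C : ℕ → Type u) [∀ k, NonUnitalCStarAlgebra (C k)] (k : ℕ) :
    lp C ∞ →⋆ₙₐ[ℂ] lp C ∞ where
  toFun x := ⟨fun i => if i < k then 0 else x i, memℓp_infty ⟨‖x‖, by
    rintro _ ⟨i, rfl⟩
    dsimp only
    split_ifs
    · simp
    · exact lp.norm_apply_le_norm ENNReal.top_ne_zero x i⟩⟩
  map_smul' c x := by
    ext i
    change (if i < k then 0 else c • x i) = c • (if i < k then 0 else x i)
    split_ifs <;> simp
  map_zero' := by
    ext i
    change (if i < k then 0 else 0) = (0 : C i)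
    simp
  map_add' x y := by
    ext i
    change (if i < k then 0 else x i + y i) =
      (if i < k then 0 else x i) + (if i < k then 0 else y i)
    split_ifs <;> simp
  map_mul' x y := by
    ext i
    change (if i < k then 0 else x i * y i) =
      (if i < k then 0 else x i) * (if i < k then 0 else y i)
    split_ifs <;> simp
  map_star' x := by
    ext i
    change (if i < k then 0 else star (x i)) = star (if i < k then 0 else x i)
    split_ifs <;> simp

theorem truncation_apply {C : ℕ → Type u} [∀ k, NonUnitalCStarAlgebra (C k)] (k : ℕ)
    (x : lp C ∞) (i : ℕ) : truncation C k x i = if i < k then 0 else x i := rfl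

theorem truncation_truncation {C : ℕ → Type u} [∀ k, NonUnitalCStarAlgebra (C k)] {k l : ℕ}
    (h : k ≤ l) (x : lp C ∞) : truncation C k (truncation C l x) = truncation C l x := by
  ext i
  simp only [truncation_apply]
  split_ifs <;> first | rfl | omega

theorem truncation_truncation_of_le {C : ℕ → Type u} [∀ k, NonUnitalCStarAlgebra (C k)] {k l : ℕ}
    (h : k ≤ l) (x : lp C ∞) : truncation C l (truncation C k x) = truncation C l x := by
  ext i
  simp only [truncation_apply]
  split_ifs <;> first | rfl | omega

section Telescope

variable {C : ℕ → Type u} [∀ k, NonUnitalCStarAlgebra (C k)]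
  (γ : ∀ k, C k →⋆ₙₐ[ℂ] C (k + 1)) {L : Type u} [NonUnitalCStarAlgebra L]
  (μ : ∀ k, C k →⋆ₙₐ[ℂ] L)

/-- Bounded sequences that eventually follow the connecting morphisms, together with the element
of the limit that they represent. -/
noncomputable def eventualThreads : NonUnitalStarSubalgebra ℂ (lp C ∞ × L) where
  carrier := {x | ∀ᶠ n in atTop, γ n (x.1 n) = x.1 (n + 1) ∧ μ n (x.1 n) = x.2}
  zero_mem' := by simp
  add_mem' {x y} hx hy := by
    filter_upwards [hx, hy] with n hx hy
    simp [hx, hy]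
  mul_mem' {x y} hx hy := by
    filter_upwards [hx, hy] with n hx hy
    simp [hx, hy]
  smul_mem' c x hx := by
    filter_upwards [hx] with n hx
    simp [hx]
  star_mem' {x} hx := by
    filter_upwards [hx] with n hx
    simp [hx, map_star]

/-- Truncation of the sequence, leaving the element of the limit unchanged. -/
noncomputable def truncationProd (C : ℕ → Type u) [∀ k, NonUnitalCStarAlgebra (C k)]
    (L : Type u) [NonUnitalCStarAlgebra L] (k : ℕ) : lp C ∞ × L →⋆ₙₐ[ℂ] lp C ∞ × L :=
  ((truncation C k).comp (NonUnitalStarAlgHom.fst ℂ _ _)).prod (NonUnitalStarAlgHom.snd ℂ _ _)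

theorem truncationProd_apply (k : ℕ) (x : lp C ∞ × L) :
    truncationProd C L k x = (truncation C k x.1, x.2) := rfl

theorem truncationProd_mem_eventualThreads (k : ℕ) {x : lp C ∞ × L}
    (hx : x ∈ eventualThreads γ μ) : truncationProd C L k x ∈ eventualThreads γ μ := by
  change ∀ᶠ n in atTop, _
  filter_upwards [hx, eventually_ge_atTop k] with n hx hn
  simpa [truncationProd_apply, truncation_apply, hn.not_gt, (Nat.le_succ_of_le hn).not_gt] using hx

theorem truncationProd_mem_closure (k : ℕ) {x : lp C ∞ × L}
    (hx : x ∈ (eventualThreads γ μ).topologicalClosure) :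
    truncationProd C L k x ∈ (eventualThreads γ μ).topologicalClosure :=
  map_mem_closure (map_continuous (truncationProd C L k)) hx
    fun _ => truncationProd_mem_eventualThreads γ μ k

/-- The discrete mapping telescope from stage `k` on: limits of eventual threads whose first `k`
entries vanish. -/
noncomputable def telescope (k : ℕ) : NonUnitalStarSubalgebra ℂ (lp C ∞ × L) :=
  (eventualThreads γ μ).topologicalClosure ⊓
    NonUnitalStarAlgHom.equalizer (truncationProd C L k) (NonUnitalStarAlgHom.id ℂ _)

theorem mem_telescope {k : ℕ} {x : lp C ∞ × L} :
    x ∈ telescope γ μ k ↔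
      x ∈ (eventualThreads γ μ).topologicalClosure ∧ truncation C k x.1 = x.1 := by
  rw [telescope, NonUnitalStarAlgebra.mem_inf]
  refine and_congr_right fun _ => ?_
  change truncationProd C L k x = x ↔ _
  simp [truncationProd_apply, Prod.ext_iff]

instance isClosed_telescope (k : ℕ) : IsClosed (telescope γ μ k : Set (lp C ∞ × L)) :=
  (NonUnitalStarSubalgebra.isClosed_topologicalClosure _).inter
    (isClosed_eq (map_continuous (truncationProd C L k)) continuous_id)

/-- The connecting morphism of the telescope, given by truncation. -/
noncomputable def telescopeMap (k : ℕ) : telescope γ μ k →⋆ₙₐ[ℂ] telescope γ μ (k + 1) :=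
  NonUnitalStarAlgHom.codRestrict
    ((truncationProd C L (k + 1)).comp
      (NonUnitalStarSubalgebraClass.subtype (telescope γ μ k))) _
    fun x => (mem_telescope γ μ).2
      ⟨truncationProd_mem_closure γ μ _ ((mem_telescope γ μ).1 x.2).1,
        truncation_truncation le_rfl _⟩

/-- The limit morphism of the telescope. -/
noncomputable def telescopeLimit (k : ℕ) : telescope γ μ k →⋆ₙₐ[ℂ] L :=
  (NonUnitalStarAlgHom.snd ℂ _ _).comp (NonUnitalStarSubalgebraClass.subtype (telescope γ μ k))

/-- Evaluation of telescope elements at the `n`-th entry. -/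
noncomputable def telescopeEval (k n : ℕ) : telescope γ μ k →⋆ₙₐ[ℂ] C n where
  toFun x := x.1.1 n
  map_smul' _ _ := rfl
  map_zero' := rfl
  map_add' _ _ := rfl
  map_mul' _ _ := rfl
  map_star' _ := rfl

theorem telescopeMap_surjective (k : ℕ) : Function.Surjective (telescopeMap γ μ k) := by
  intro x
  obtain ⟨hx, hk⟩ := (mem_telescope γ μ).1 x.2
  have hk' : truncation C k x.1.1 = x.1.1 := by
    rw [← hk, truncation_truncation k.le_succ]
  exact ⟨⟨x.1, (mem_telescope γ μ).2 ⟨hx, hk'⟩⟩, Subtype.ext (Prod.ext hk rfl)⟩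

theorem iterHom_telescopeMap (k n : ℕ) (x : telescope γ μ k) :
    (iterHom (A := fun k => telescope γ μ k) (telescopeMap γ μ) k n x : lp C ∞ × L) =
      truncationProd C L (k + n) x := by
  induction n with
  | zero => exact Prod.ext ((mem_telescope γ μ).1 x.2).2.symm rfl
  | succ n ih =>
    change truncationProd C L (k + n + 1)
      (iterHom (A := fun k => telescope γ μ k) (telescopeMap γ μ) k n x : lp C ∞ × L) = _
    rw [ih]
    exact Prod.ext (truncation_truncation_of_le (k + n).le_succ _) rfl

theorem iterHom_eq_of_forall_eq {N : ℕ} {x : lp C ∞}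
    (hx : ∀ n ≥ N, γ n (x n) = x (n + 1)) (m : ℕ) : iterHom γ N m (x N) = x (N + m) := by
  induction m with
  | zero => rfl
  | succ m ih =>
    change γ (N + m) (iterHom γ N m (x N)) = _
    rw [ih, hx _ (Nat.le_add_right N m)]
    rfl

variable {γ μ}

theorem IsInductiveLimit.tendsto_norm_of_mem_eventualThreads (h : IsInductiveLimit γ L μ)
    {x : lp C ∞ × L} (hx : x ∈ eventualThreads γ μ) :
    Tendsto (fun n => ‖x.1 n‖) atTop (𝓝 ‖x.2‖) := by
  obtain ⟨N, hN⟩ := eventually_atTop.1 (show ∀ᶠ n in atTop, _ from hx)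
  have key := h.norm_tendsto N (x.1 N)
  simp only [iterHom_eq_of_forall_eq γ (fun n hn => (hN n hn).1), (hN N le_rfl).2] at key
  rw [← tendsto_add_atTop_iff_nat N]
  exact key.congr fun n => by rw [Nat.add_comm]

theorem tendsto_map_apply_of_mem_closure {x : lp C ∞ × L}
    (hx : x ∈ (eventualThreads γ μ).topologicalClosure) :
    Tendsto (fun n => μ n (x.1 n)) atTop (𝓝 x.2) := by
  rw [Metric.tendsto_atTop']
  intro ε hε
  obtain ⟨y, hy, hxy⟩ := Metric.mem_closure_iff.1 hx (ε / 2) (half_pos hε)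
  obtain ⟨N, hN⟩ := eventually_atTop.1 (show ∀ᶠ n in atTop, _ from hy)
  refine ⟨N, fun n hn => ?_⟩
  rw [dist_eq_norm] at hxy
  have h1 : ‖μ n (x.1 n) - y.2‖ < ε / 2 := by
    rw [← (hN n hn.le).2, ← map_sub]
    calc _ ≤ ‖(x.1 - y.1) n‖ := NonUnitalStarAlgHom.norm_apply_le (μ n) _
      _ ≤ ‖x.1 - y.1‖ := lp.norm_apply_le_norm ENNReal.top_ne_zero _ n
      _ ≤ ‖x - y‖ := norm_fst_le (x - y)
      _ < _ := hxy
  have h2 : ‖y.2 - x.2‖ < ε / 2 := by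
    rw [norm_sub_rev]
    exact (norm_snd_le (x - y)).trans_lt hxy
  rw [dist_eq_norm]
  calc _ ≤ ‖μ n (x.1 n) - y.2‖ + ‖y.2 - x.2‖ := norm_sub_le_norm_sub_add_norm_sub _ _ _
    _ < ε := by linarith

theorem IsInductiveLimit.tendsto_norm_truncationProd (h : IsInductiveLimit γ L μ)
    {x : lp C ∞ × L} (hx : x ∈ (eventualThreads γ μ).topologicalClosure) :
    Tendsto (fun n => ‖truncationProd C L n x‖) atTop (𝓝 ‖x.2‖) := by
  rw [Metric.tendsto_atTop']
  intro ε hε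
  obtain ⟨y, hy, hxy⟩ := Metric.mem_closure_iff.1 hx (ε / 4) (by positivity)
  rw [dist_eq_norm] at hxy
  obtain ⟨N, hN⟩ := eventually_atTop.1
    ((h.tendsto_norm_of_mem_eventualThreads hy).eventually_le_const
      (lt_add_of_pos_right ‖y.2‖ (by positivity : 0 < ε / 4)))
  have hy2 : ‖y.2‖ ≤ ‖x.2‖ + ε / 4 := by
    have := norm_snd_le (x - y)
    have := norm_sub_norm_le y.2 x.2
    rw [norm_sub_rev] at this
    simp only [Prod.snd_sub] at *
    linarith
  refine ⟨N, fun n hn => ?_⟩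
  have hty : ‖truncationProd C L n y‖ ≤ ‖y.2‖ + ε / 4 := by
    refine norm_prod_le_iff.2 ⟨lp.norm_le_of_forall_le (by positivity) fun i => ?_, ?_⟩
    · simp only [truncationProd_apply, truncation_apply]
      split_ifs with hi
      · rw [norm_zero]
        positivity
      · exact hN i (by omega)
    · simp only [truncationProd_apply]
      linarith
  have htx : ‖truncationProd C L n x‖ ≤ ‖truncationProd C L n y‖ + ε / 4 := by
    have h1 := NonUnitalStarAlgHom.norm_apply_le (truncationProd C L n) (x - y)
    rw [map_sub] at h1
    have h2 := norm_sub_norm_le (truncationProd C L n x) (truncationProd C L n y)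
    linarith
  have hlow : ‖x.2‖ ≤ ‖truncationProd C L n x‖ := norm_snd_le (truncationProd C L n x)
  rw [Real.dist_eq, abs_lt]
  constructor <;> linarith

theorem IsInductiveLimit.exists_mem_eventualThreads (h : IsInductiveLimit γ L μ) {N : ℕ}
    (a : C N) : ∃ x ∈ eventualThreads γ μ, x.2 = μ N a := by
  let c : ∀ n, N ≤ n → C n := fun n hn =>
    Nat.leRec (motive := fun n _ => C n) a (fun k _ b => γ k b) hn
  have c_self : c N le_rfl = a := Nat.leRec_self ..
  have c_succ : ∀ n (hn : N ≤ n), c (n + 1) (Nat.le_succ_of_le hn) = γ n (c n hn) :=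
    fun n hn => Nat.leRec_succ ..
  have c_norm : ∀ n (hn : N ≤ n), ‖c n hn‖ ≤ ‖a‖ := fun n hn => by
    induction n, hn using Nat.le_induction with
    | base => rw [c_self]
    | succ n hn ih =>
      rw [c_succ n hn]
      exact (NonUnitalStarAlgHom.norm_apply_le (γ n) _).trans ih
  have c_map : ∀ n (hn : N ≤ n), μ n (c n hn) = μ N a := fun n hn => by
    induction n, hn using Nat.le_induction with
    | base => rw [c_self]
    | succ n hn ih =>
      rw [c_succ n hn, ← ih, ← h.compat n]
      rfl
  let s : lp C ∞ := ⟨fun n => if hn : N ≤ n then c n hn else 0, memℓp_infty ⟨‖a‖, by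
    rintro _ ⟨n, rfl⟩
    dsimp only
    split_ifs with hn
    · exact c_norm n hn
    · simp⟩⟩
  have s_apply : ∀ n (hn : N ≤ n), s n = c n hn := fun n hn => dif_pos hn
  refine ⟨(s, μ N a), ?_, rfl⟩
  change ∀ᶠ n in atTop, _
  filter_upwards [eventually_ge_atTop N] with n hn
  rw [s_apply n hn, s_apply (n + 1) (Nat.le_succ_of_le hn), c_succ n hn]
  exact ⟨rfl, c_map n hn⟩

theorem IsInductiveLimit.telescope (h : IsInductiveLimit γ L μ) :
    IsInductiveLimit (A := fun k => telescope γ μ k) (telescopeMap γ μ) L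
      (telescopeLimit γ μ) where
  compat _ := rfl
  dense_union := by
    refine h.dense_union.mono (iUnion_subset fun N => ?_)
    rintro _ ⟨a, rfl⟩
    obtain ⟨x, hx, hxa⟩ := h.exists_mem_eventualThreads a
    refine mem_iUnion.2 ⟨0, ⟨x, (mem_telescope γ μ).2
      ⟨NonUnitalStarSubalgebra.le_topologicalClosure _ hx, ?_⟩⟩, hxa⟩
    ext i
    simp [truncation_apply]
  norm_tendsto k x := by
    have hx := ((mem_telescope γ μ).1 x.2).1
    have key := (tendsto_add_atTop_iff_nat k).2 (h.tendsto_norm_truncationProd hx)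
    refine key.congr fun n => ?_
    rw [Nat.add_comm n k, ← iterHom_telescopeMap]
    rfl

end Telescope

/-- A weakly semiprojective morphism `φ : A → B` admits approximate lifts along any
inductive limit: for `σ : B → C = lim C_k`, `ε > 0` and finite `F ⊆ A` there are `k` and
`ψ : A → C_k` with `‖γ_{∞,k}(ψ x) − σ(φ x)‖ < ε` on `F`. -/
theorem weaklySemiprojective_approximate_lift
    {A B : Type u} [NonUnitalCStarAlgebra A] [NonUnitalCStarAlgebra B]
    (φ : A →⋆ₙₐ[ℂ] B) (hφ : IsWeaklySemiprojectiveMorphism φ)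
    (C : ℕ → Type u) [∀ k, NonUnitalCStarAlgebra (C k)]
    (γ : ∀ k, C k →⋆ₙₐ[ℂ] C (k + 1))
    (L : Type u) [NonUnitalCStarAlgebra L] (μ : ∀ k, C k →⋆ₙₐ[ℂ] L)
    (hlim : IsInductiveLimit γ L μ) (σ : B →⋆ₙₐ[ℂ] L)
    (ε : ℝ) (hε : 0 < ε) (F : Finset A) :
    ∃ (k : ℕ) (ψ : A →⋆ₙₐ[ℂ] C k), ∀ x ∈ F, ‖μ k (ψ x) - σ (φ x)‖ < ε := by
  obtain ⟨k, ψ, hψ⟩ := hφ (fun k => telescope γ μ k) (telescopeMap γ μ)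
    (telescopeMap_surjective γ μ) L (telescopeLimit γ μ) hlim.telescope σ ε hε F
  have hev : ∀ᶠ n in atTop, ∀ x ∈ F, ‖μ n (telescopeEval γ μ k n (ψ x)) - σ (φ x)‖ < ε := by
    refine (Finset.eventually_all F).2 fun x hx => ?_
    have key := tendsto_map_apply_of_mem_closure ((mem_telescope γ μ).1 (ψ x).2).1
    exact (key.sub_const (σ (φ x))).norm.eventually_lt_const (hψ x hx)
  obtain ⟨n, hn⟩ := hev.exists
  exact ⟨n, (telescopeEval γ μ k n).comp ψ, hn⟩
end

section
/- (Criterion: A𝒞-like implies A𝒞.) Let (C_i)_{i∈I} be a family of weakly semiprojective C*-algebras and let A be a separable C*-algebra. Suppose that for every finite subset F ⊆ A and every ε > 0 there exists a sub-C*-algebra B ⊆ A such that F ⊂_ε B and B is isomorphic to the inductive limit of some inductive system all of whose terms belong to the family (C_i)_{i∈I}. Then A itself is isomorphic to the inductive limit of an inductive system all of whose terms belong to the family (C_i)_{i∈I}. -/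
open Filter Topology Set

noncomputable section TailSystem

open scoped ENNReal

open TopologicalSpace

theorem isSeparable_adjoin {A : Type*} [NonUnitalCStarAlgebra A] {s : Set A} (hs : s.Countable) :
    IsSeparable (NonUnitalStarAlgebra.adjoin ℂ s : Set A) := by
  have hcl : (Subsemigroup.closure (s ∪ star s) : Set A).Countable := by
    have hT : (s ∪ star s).Countable := hs.union (by rw [← Set.image_star]; exact hs.image _)
    have := hT.to_subtype
    let f : List (s ∪ star s : Set A) → Unitization ℂ A :=
      fun l =>
        (l.map fun x : (s ∪ star s : Set A) => (Unitization.inr (x : A) : Unitization ℂ A)).prod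
    refine ((Set.countable_range f).preimage_of_injOn
      (f := ((↑) : A → Unitization ℂ A)) Unitization.inr_injective.injOn).mono ?_
    intro x hx
    induction hx using Subsemigroup.closure_induction with
    | mem x hx => exact ⟨[⟨x, hx⟩], by simp [f]⟩
    | mul x y _ _ hx hy =>
      obtain ⟨l, hl⟩ := hx
      obtain ⟨l', hl'⟩ := hy
      refine ⟨l ++ l', ?_⟩
      simp only [f] at hl hl' ⊢
      rw [List.map_append, List.prod_append, hl, hl', Unitization.inr_mul]
  have h := (hcl.isSeparable).span (R := ℂ)
  have he := NonUnitalStarAlgebra.adjoin_eq_span (R := ℂ) s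
  rw [← he] at h
  exact h

variable {D : ℕ → Type u} [∀ n, NonUnitalCStarAlgebra (D n)]
  {L : Type u} [NonUnitalCStarAlgebra L]

/-- Replace the entries of index less than `k` of a bounded sequence by `0`. -/
def truncSeq (k : ℕ) : lp D ∞ →⋆ₙₐ[ℂ] lp D ∞ where
  toFun x := ⟨fun n => if n < k then 0 else x n, memℓp_infty ⟨‖x‖, by
    rintro _ ⟨n, rfl⟩
    dsimp only
    split_ifs
    · simp
    · exact lp.norm_apply_le_norm (by simp) x n⟩⟩
  map_smul' c x := by ext n; by_cases h : n < k <;> simp [h]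
  map_zero' := by ext n; simp
  map_add' x y := by
    ext n
    change (if n < k then 0 else x n + y n) = (if n < k then 0 else x n) + if n < k then 0 else y n
    split_ifs <;> simp
  map_mul' x y := by ext n; by_cases h : n < k <;> simp [h]
  map_star' x := by ext n; by_cases h : n < k <;> simp [h]

theorem truncSeq_apply (k : ℕ) (x : lp D ∞) (n : ℕ) :
    truncSeq k x n = if n < k then 0 else x n := rfl

/-- The `n`-th entry of a bounded sequence. -/
def evalSeq (n : ℕ) : lp D ∞ →⋆ₙₐ[ℂ] D n where
  toFun x := x n
  map_smul' _ _ := rfl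
  map_zero' := rfl
  map_add' _ _ := rfl
  map_mul' _ _ := rfl
  map_star' _ := rfl

/-- Truncation of the first component. -/
def truncPair (L : Type u) [NonUnitalCStarAlgebra L] (k : ℕ) :
    lp D ∞ × L →⋆ₙₐ[ℂ] lp D ∞ × L :=
  ((truncSeq k).comp (NonUnitalStarAlgHom.fst ℂ (lp D ∞) L)).prod
    (NonUnitalStarAlgHom.snd ℂ (lp D ∞) L)

theorem truncPair_fst (k : ℕ) (x : lp D ∞ × L) : (truncPair L k x).1 = truncSeq k x.1 := rfl

theorem truncPair_snd (k : ℕ) (x : lp D ∞ × L) : (truncPair L k x).2 = x.2 := rfl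

theorem truncPair_truncPair (k l : ℕ) (x : lp D ∞ × L) :
    truncPair L k (truncPair L l x) = truncPair L (max k l) x := by
  refine Prod.ext ?_ rfl
  ext n
  simp only [truncPair_fst, truncSeq_apply]
  by_cases h : n < k <;> by_cases h' : n < l <;> simp [h, h']

theorem NonUnitalStarAlgHom.continuous_complex {A B : Type*} [NonUnitalCStarAlgebra A]
    [NonUnitalCStarAlgebra B] (f : A →⋆ₙₐ[ℂ] B) : Continuous f :=
  (NonUnitalStarAlgHom.instContinuousLinearMapClassComplex (F := A →⋆ₙₐ[ℂ] B)).map_continuous f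

/-- The elements of the closure of `Q` whose first component vanishes below `k`. -/
def tailAlg (Q : NonUnitalStarSubalgebra ℂ (lp D ∞ × L)) (k : ℕ) :
    NonUnitalStarSubalgebra ℂ (lp D ∞ × L) :=
  Q.topologicalClosure ⊓ NonUnitalStarAlgHom.equalizer (truncPair L k) (NonUnitalStarAlgHom.id ℂ _)

instance isClosed_tailAlg (Q : NonUnitalStarSubalgebra ℂ (lp D ∞ × L)) (k : ℕ) :
    IsClosed (tailAlg Q k : Set (lp D ∞ × L)) :=
  Q.isClosed_topologicalClosure.inter
    (isClosed_eq (truncPair L k).continuous_complex continuous_id)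

theorem truncPair_mem_tailAlg {Q : NonUnitalStarSubalgebra ℂ (lp D ∞ × L)}
    (hQ : ∀ k, ∀ x ∈ Q, truncPair L k x ∈ Q) (k : ℕ) {x : lp D ∞ × L}
    (hx : x ∈ Q.topologicalClosure) : truncPair L k x ∈ tailAlg Q k :=
  ⟨map_mem_closure (truncPair L k).continuous_complex hx (hQ k), by
    simp [NonUnitalStarAlgHom.mem_equalizer, truncPair_truncPair]⟩

/-- The connecting morphisms of the system of tail algebras. -/
def tailConn {Q : NonUnitalStarSubalgebra ℂ (lp D ∞ × L)}
    (hQ : ∀ k, ∀ x ∈ Q, truncPair L k x ∈ Q) (k : ℕ) : tailAlg Q k →⋆ₙₐ[ℂ] tailAlg Q (k + 1) :=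
  NonUnitalStarAlgHom.codRestrict
    ((truncPair L (k + 1)).comp (NonUnitalStarSubalgebraClass.subtype (tailAlg Q k))) _
    fun x => truncPair_mem_tailAlg hQ _ x.2.1

theorem coe_tailConn {Q : NonUnitalStarSubalgebra ℂ (lp D ∞ × L)}
    (hQ : ∀ k, ∀ x ∈ Q, truncPair L k x ∈ Q) (k : ℕ) (x : tailAlg Q k) :
    (tailConn hQ k x : lp D ∞ × L) = truncPair L (k + 1) x := rfl

/-- The second component, as the limit morphism of the system of tail algebras. -/
def tailLim (Q : NonUnitalStarSubalgebra ℂ (lp D ∞ × L)) (k : ℕ) : tailAlg Q k →⋆ₙₐ[ℂ] L :=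
  (NonUnitalStarAlgHom.snd ℂ (lp D ∞) L).comp (NonUnitalStarSubalgebraClass.subtype (tailAlg Q k))

theorem tailLim_apply (Q : NonUnitalStarSubalgebra ℂ (lp D ∞ × L)) (k : ℕ) (x : tailAlg Q k) :
    tailLim Q k x = (x : lp D ∞ × L).2 := rfl

theorem tailConn_surjective {Q : NonUnitalStarSubalgebra ℂ (lp D ∞ × L)}
    (hQ : ∀ k, ∀ x ∈ Q, truncPair L k x ∈ Q) (k : ℕ) : Function.Surjective (tailConn hQ k) := by
  rintro ⟨x, hx⟩
  refine ⟨⟨x, hx.1, ?_⟩, Subtype.ext hx.2⟩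
  have h : truncPair L (k + 1) x = x := hx.2
  change truncPair L k x = x
  rw [← h, truncPair_truncPair]
  simp

theorem coe_iterHom_tailConn {Q : NonUnitalStarSubalgebra ℂ (lp D ∞ × L)}
    (hQ : ∀ k, ∀ x ∈ Q, truncPair L k x ∈ Q) (k n : ℕ) (x : tailAlg Q k) :
    (iterHom (tailConn hQ) k n x : lp D ∞ × L) = truncPair L (k + n) x := by
  induction n with
  | zero => exact x.2.2.symm
  | succ n ih =>
    change (tailConn hQ (k + n) (iterHom (tailConn hQ) k n x) : lp D ∞ × L) = _
    rw [coe_tailConn, ih, truncPair_truncPair]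
    congr 2
    omega

/-- The property that the entries of a bounded sequence are asymptotically bounded by the norm
of the second component passes to the closure. -/
theorem eventually_norm_le_of_mem_closure {Q : NonUnitalStarSubalgebra ℂ (lp D ∞ × L)}
    (hnorm : ∀ x ∈ Q, ∀ ε : ℝ, 0 < ε → ∀ᶠ n in atTop, ‖x.1 n‖ ≤ ‖x.2‖ + ε)
    {x : lp D ∞ × L} (hx : x ∈ Q.topologicalClosure) {ε : ℝ} (hε : 0 < ε) :
    ∀ᶠ n in atTop, ‖x.1 n‖ ≤ ‖x.2‖ + ε := by
  obtain ⟨y, hy, hxy⟩ := Metric.mem_closure_iff.1 (show x ∈ closure (Q : Set (lp D ∞ × L)) from hx)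
    (ε / 3) (by positivity)
  rw [dist_eq_norm] at hxy
  filter_upwards [hnorm y hy (ε / 3) (by positivity)] with n hn
  have h1 : ‖x.1 n - y.1 n‖ ≤ ‖x - y‖ :=
    (lp.norm_apply_le_norm (by simp) (x.1 - y.1) n).trans (norm_fst_le (x - y))
  have h2 : ‖x.2 - y.2‖ ≤ ‖x - y‖ := norm_snd_le (x - y)
  have h3 := norm_sub_norm_le (x.1 n) (y.1 n)
  have h4 := norm_sub_norm_le (y.2) (x.2)
  rw [norm_sub_rev] at h4
  linarith

theorem tendsto_of_mem_closure {Q : NonUnitalStarSubalgebra ℂ (lp D ∞ × L)}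
    (φ : ∀ n, D n →⋆ₙₐ[ℂ] L)
    (hφ : ∀ x ∈ Q, Tendsto (fun n => φ n (x.1 n)) atTop (𝓝 x.2))
    {x : lp D ∞ × L} (hx : x ∈ Q.topologicalClosure) :
    Tendsto (fun n => φ n (x.1 n)) atTop (𝓝 x.2) := by
  rw [Metric.tendsto_atTop]
  intro ε hε
  obtain ⟨y, hy, hxy⟩ := Metric.mem_closure_iff.1 (show x ∈ closure (Q : Set (lp D ∞ × L)) from hx)
    (ε / 3) (by positivity)
  obtain ⟨N, hN⟩ := Metric.tendsto_atTop.1 (hφ y hy) (ε / 3) (by positivity)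
  refine ⟨N, fun n hn => ?_⟩
  have h0 := hN n hn
  rw [dist_eq_norm] at hxy
  have h1 : ‖x.1 n - y.1 n‖ ≤ ‖x - y‖ :=
    (lp.norm_apply_le_norm (by simp) (x.1 - y.1) n).trans (norm_fst_le (x - y))
  have h2 : ‖x.2 - y.2‖ ≤ ‖x - y‖ := norm_snd_le (x - y)
  have h3 : dist (φ n (x.1 n)) (φ n (y.1 n)) ≤ ‖x.1 n - y.1 n‖ := by
    rw [dist_eq_norm, ← map_sub]
    exact NonUnitalStarAlgHom.norm_apply_le _ _
  have h4 := dist_triangle4 (φ n (x.1 n)) (φ n (y.1 n)) y.2 x.2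
  rw [dist_comm y.2, dist_eq_norm x.2] at h4
  linarith

theorem isInductiveLimit_tail {Q : NonUnitalStarSubalgebra ℂ (lp D ∞ × L)}
    (hQ : ∀ k, ∀ x ∈ Q, truncPair L k x ∈ Q)
    (hnorm : ∀ x ∈ Q, ∀ ε : ℝ, 0 < ε → ∀ᶠ n in atTop, ‖x.1 n‖ ≤ ‖x.2‖ + ε)
    (hdense : Dense (Prod.snd '' (Q : Set (lp D ∞ × L)))) :
    IsInductiveLimit (tailConn hQ) L (tailLim Q) where
  compat k := rfl
  dense_union := by
    refine hdense.mono ?_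
    rintro _ ⟨x, hx, rfl⟩
    exact Set.mem_iUnion.2 ⟨0, ⟨_, truncPair_mem_tailAlg hQ 0 (Q.le_topologicalClosure hx)⟩, rfl⟩
  norm_tendsto k x := by
    rw [Metric.tendsto_atTop]
    intro ε hε
    obtain ⟨N, hN⟩ := eventually_atTop.1
      (eventually_norm_le_of_mem_closure hnorm x.2.1 (half_pos hε))
    refine ⟨N, fun n hn => ?_⟩
    have h1 : ‖iterHom (tailConn hQ) k n x‖ = ‖truncPair L (k + n) (x : lp D ∞ × L)‖ := by
      rw [← coe_iterHom_tailConn hQ]; rfl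
    have h2 : ‖(x : lp D ∞ × L).2‖ ≤ ‖truncPair L (k + n) (x : lp D ∞ × L)‖ :=
      norm_snd_le (truncPair L (k + n) (x : lp D ∞ × L))
    have h3 : ‖truncPair L (k + n) (x : lp D ∞ × L)‖ ≤ ‖(x : lp D ∞ × L).2‖ + ε / 2 := by
      rw [Prod.norm_def]
      refine max_le (lp.norm_le_of_forall_le (by positivity) fun m => ?_) ?_
      · rw [truncPair_fst, truncSeq_apply]
        split_ifs with h
        · rw [norm_zero]; positivity
        · exact hN m (by omega)
      · rw [truncPair_snd]; linarith
    rw [h1, tailLim_apply, Real.dist_eq, abs_lt]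
    constructor <;> linarith

/-- Weak semiprojectivity lets one lift a morphism into `L` to the terms of a sequence that
approximates `L`, with separable range. -/
theorem IsWeaklySemiprojective.exists_lift {C : Type u} [NonUnitalCStarAlgebra C]
    (hC : IsWeaklySemiprojective C) [SeparableSpace L] (φ : ∀ n, D n →⋆ₙₐ[ℂ] L)
    (Q : NonUnitalStarSubalgebra ℂ (lp D ∞ × L))
    (hQ : ∀ k, ∀ x ∈ Q, truncPair L k x ∈ Q)
    (hnorm : ∀ x ∈ Q, ∀ ε : ℝ, 0 < ε → ∀ᶠ n in atTop, ‖x.1 n‖ ≤ ‖x.2‖ + ε)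
    (hφ : ∀ x ∈ Q, Tendsto (fun n => φ n (x.1 n)) atTop (𝓝 x.2))
    (hdense : Dense (Prod.snd '' (Q : Set (lp D ∞ × L))))
    (σ : C →⋆ₙₐ[ℂ] L) (F : Finset C) {ε : ℝ} (hε : 0 < ε) :
    ∀ᶠ n in atTop, ∃ ψ : C →⋆ₙₐ[ℂ] D n, IsSeparable (Set.range ψ) ∧
      ∀ c ∈ F, ‖φ n (ψ c) - σ c‖ < ε ∧ ‖ψ c‖ < ‖σ c‖ + ε := by
  obtain ⟨t, htQ, htc, htd⟩ : ∃ t : Set (lp D ∞ × L), t ⊆ Q ∧ t.Countable ∧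
      Dense (Prod.snd '' t) := by
    obtain ⟨s, hsQ, hsc, hsd⟩ := (IsSeparable.of_separableSpace
      (Prod.snd '' (Q : Set (lp D ∞ × L)))).exists_countable_dense_subset
    have := hsc.to_subtype
    choose f hf hfs using fun y : s => hsQ y.2
    refine ⟨Set.range f, Set.range_subset_iff.2 hf, Set.countable_range f, ?_⟩
    have : Prod.snd '' Set.range f = s := by
      rw [← Set.range_comp]
      ext y
      exact ⟨by rintro ⟨z, rfl⟩; rw [Function.comp_apply, hfs z]; exact z.2,
        fun hy => ⟨⟨y, hy⟩, hfs ⟨y, hy⟩⟩⟩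
    rw [this]
    exact dense_closure.1 (hdense.mono hsd)
  set T : Set (lp D ∞ × L) := t ∪ ⋃ k, truncPair L k '' t with hT
  have hTc : T.Countable := htc.union (Set.countable_iUnion fun k => htc.image _)
  have hTQ : T ⊆ Q := by
    refine Set.union_subset htQ (Set.iUnion_subset fun k => ?_)
    rintro _ ⟨x, hx, rfl⟩
    exact hQ k x (htQ hx)
  set P := NonUnitalStarAlgebra.adjoin ℂ T with hP
  have hPQ : P ≤ Q := NonUnitalStarAlgebra.adjoin_le hTQ
  have hPt : ∀ k, ∀ x ∈ P, truncPair L k x ∈ P := by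
    intro k
    have : P ≤ NonUnitalStarSubalgebra.comap (truncPair L k) P := by
      refine NonUnitalStarAlgebra.adjoin_le ?_
      rintro x (hx | hx)
      · exact NonUnitalStarAlgebra.subset_adjoin ℂ T
          (Or.inr (Set.mem_iUnion.2 ⟨k, x, hx, rfl⟩))
      · obtain ⟨l, y, hy, rfl⟩ := Set.mem_iUnion.1 hx
        change truncPair L k (truncPair L l y) ∈ P
        rw [truncPair_truncPair]
        exact NonUnitalStarAlgebra.subset_adjoin ℂ T
          (Or.inr (Set.mem_iUnion.2 ⟨_, y, hy, rfl⟩))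
    exact fun x hx => this hx
  have hPd : Dense (Prod.snd '' (P : Set (lp D ∞ × L))) :=
    htd.mono (Set.image_mono
      (Set.subset_union_left.trans (NonUnitalStarAlgebra.subset_adjoin ℂ T)))
  have hPn : ∀ x ∈ P, ∀ ε : ℝ, 0 < ε → ∀ᶠ n in atTop, ‖x.1 n‖ ≤ ‖x.2‖ + ε :=
    fun x hx => hnorm x (hPQ hx)
  have hPφ := fun x hx => hφ x (hPQ hx)
  have hPs : IsSeparable (P.topologicalClosure : Set (lp D ∞ × L)) :=
    (isSeparable_adjoin hTc).closure
  obtain ⟨k, ψ, hψ⟩ := hC (fun k => tailAlg P k) (tailConn hPt) (tailConn_surjective hPt) L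
    (tailLim P) (isInductiveLimit_tail hPt hPn hPd) σ (ε / 2) (half_pos hε) F
  have h1 : ∀ c ∈ F, ∀ᶠ n in atTop, ‖φ n ((ψ c : lp D ∞ × L).1 n) - σ c‖ < ε ∧
      ‖(ψ c : lp D ∞ × L).1 n‖ < ‖σ c‖ + ε := by
    intro c hc
    have h0 : ‖(ψ c : lp D ∞ × L).2 - σ c‖ < ε / 2 := hψ c hc
    filter_upwards [Metric.tendsto_nhds.1 (tendsto_of_mem_closure φ hPφ (ψ c).2.1) (ε / 2)
      (half_pos hε), eventually_norm_le_of_mem_closure hPn (ψ c).2.1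
      (sub_pos.2 h0)] with n hn hn'
    rw [dist_eq_norm] at hn
    have h2 := norm_sub_norm_le (ψ c : lp D ∞ × L).2 (σ c)
    have h3 := norm_sub_le_norm_sub_add_norm_sub (φ n ((ψ c : lp D ∞ × L).1 n))
      (ψ c : lp D ∞ × L).2 (σ c)
    constructor <;> linarith
  filter_upwards [(Filter.eventually_all_finset F).2 h1] with n hn
  refine ⟨((evalSeq n).comp (NonUnitalStarAlgHom.fst ℂ (lp D ∞) L)).comp
    ((NonUnitalStarSubalgebraClass.subtype (tailAlg P k)).comp ψ), ?_, hn⟩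
  refine (hPs.image ((evalSeq n).comp
    (NonUnitalStarAlgHom.fst ℂ (lp D ∞) L)).continuous_complex).mono ?_
  rintro _ ⟨c, rfl⟩
  exact ⟨ψ c, (ψ c).2.1, rfl⟩

end TailSystem

section Lifting

open scoped ENNReal

open TopologicalSpace

theorem IsInductiveLimit.range_mono {X : ℕ → Type u} [∀ k, NonUnitalCStarAlgebra (X k)]
    {γ : ∀ k, X k →⋆ₙₐ[ℂ] X (k + 1)} {L : Type v} [NonUnitalCStarAlgebra L]
    {μ : ∀ k, X k →⋆ₙₐ[ℂ] L} (h : IsInductiveLimit γ L μ) :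
    Monotone fun k => Set.range (μ k) := by
  refine monotone_nat_of_le_succ fun k => ?_
  rintro _ ⟨x, rfl⟩
  exact ⟨γ k x, DFunLike.congr_fun (h.compat k) x⟩

/-- Every element of a term of an inductive system extends to a bounded sequence that is
eventually compatible with the connecting morphisms. -/
theorem exists_coherent_seq {X : ℕ → Type u} [∀ k, NonUnitalCStarAlgebra (X k)]
    (γ : ∀ k, X k →⋆ₙₐ[ℂ] X (k + 1)) (k : ℕ) (y : X k) :
    ∃ x : ∀ n, X n, (∀ n, ‖x n‖ ≤ ‖y‖) ∧ x k = y ∧ ∀ n, k ≤ n → x (n + 1) = γ n (x n) := by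
  classical
  let y' : ∀ n, X n := Function.update 0 k y
  have hy' : ∀ n, ‖y' n‖ ≤ ‖y‖ := by
    intro n
    rcases eq_or_ne n k with rfl | hn
    · simp [y']
    · simp [y', hn]
  let x : ∀ n, X n := fun n =>
    Nat.rec (y' 0) (fun n z => if k = n + 1 then y' (n + 1) else γ n z) n
  have hx : ∀ n, x (n + 1) = if k = n + 1 then y' (n + 1) else γ n (x n) := fun _ => rfl
  refine ⟨x, fun n => ?_, ?_, fun n hn => ?_⟩
  · induction n with
    | zero => exact hy' 0
    | succ n ih =>
      rw [hx]
      split_ifs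
      · exact hy' _
      · exact (NonUnitalStarAlgHom.norm_apply_le _ _).trans ih
  · have : x k = y' k := by
      cases k with
      | zero => rfl
      | succ k => rw [hx, if_pos rfl]
    rw [this]
    simp [y']
  · rw [hx, if_neg (by omega)]

theorem IsWeaklySemiprojective.exists_lift_inductiveLimit {C : Type u} [NonUnitalCStarAlgebra C]
    (hC : IsWeaklySemiprojective C) {X : ℕ → Type u} [∀ k, NonUnitalCStarAlgebra (X k)]
    {γ : ∀ k, X k →⋆ₙₐ[ℂ] X (k + 1)} {L : Type u} [NonUnitalCStarAlgebra L] [SeparableSpace L]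
    {μ : ∀ k, X k →⋆ₙₐ[ℂ] L} (h : IsInductiveLimit γ L μ)
    (σ : C →⋆ₙₐ[ℂ] L) (F : Finset C) {ε : ℝ} (hε : 0 < ε) :
    ∀ᶠ n in atTop, ∃ ψ : C →⋆ₙₐ[ℂ] X n, IsSeparable (Set.range ψ) ∧
      ∀ c ∈ F, ‖μ n (ψ c) - σ c‖ < ε ∧ ‖ψ c‖ < ‖σ c‖ + ε := by
  let Q : NonUnitalStarSubalgebra ℂ (lp X ∞ × L) :=
    { carrier := {x | ∀ᶠ n in atTop, x.1 (n + 1) = γ n (x.1 n) ∧ μ n (x.1 n) = x.2}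
      zero_mem' := Eventually.of_forall fun n => by simp
      add_mem' := by
        intro x y hx hy
        filter_upwards [hx, hy] with n hn hn'
        simp [hn.1, hn.2, hn'.1, hn'.2]
      mul_mem' := by
        intro x y hx hy
        filter_upwards [hx, hy] with n hn hn'
        simp [hn.1, hn.2, hn'.1, hn'.2]
      smul_mem' := by
        intro c x hx
        filter_upwards [hx] with n hn
        simp [hn.1, hn.2]
      star_mem' := by
        intro x hx
        filter_upwards [hx] with n hn
        simp [hn.1, hn.2, map_star] }
  have memQ : ∀ x, x ∈ Q ↔ ∀ᶠ n in atTop, x.1 (n + 1) = γ n (x.1 n) ∧ μ n (x.1 n) = x.2 :=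
    fun _ => Iff.rfl
  refine hC.exists_lift μ Q ?_ ?_ ?_ ?_ σ F hε
  · intro k x hx
    rw [memQ] at hx ⊢
    filter_upwards [hx, eventually_ge_atTop k] with n hn hk
    simp only [truncPair_fst, truncPair_snd, truncSeq_apply]
    rwa [if_neg (by omega), if_neg (by omega)]
  · intro x hx ε hε
    obtain ⟨N, hN⟩ := eventually_atTop.1 ((memQ x).1 hx)
    have hit : ∀ m, x.1 (N + m) = iterHom γ N m (x.1 N) := by
      intro m
      induction m with
      | zero => rfl
      | succ m ih =>
        change x.1 (N + m + 1) = γ (N + m) (iterHom γ N m (x.1 N))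
        rw [← ih]
        exact (hN _ (by omega)).1
    have ht := h.norm_tendsto N (x.1 N)
    rw [(hN N le_rfl).2] at ht
    obtain ⟨M, hM⟩ := eventually_atTop.1 (ht.eventually_lt_const (lt_add_of_pos_right _ hε))
    filter_upwards [eventually_ge_atTop (N + M)] with n hn
    obtain ⟨m, rfl⟩ := Nat.exists_eq_add_of_le (show N ≤ n by omega)
    rw [hit]
    exact (hM m (by omega)).le
  · intro x hx
    exact tendsto_const_nhds.congr' (((memQ x).1 hx).mono fun n hn => hn.2.symm)
  · refine h.dense_union.mono (Set.iUnion_subset fun k => ?_)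
    rintro _ ⟨y, rfl⟩
    obtain ⟨x, hxb, hxk, hx⟩ := exists_coherent_seq γ k y
    refine ⟨(⟨x, memℓp_infty ⟨‖y‖, by rintro _ ⟨n, rfl⟩; exact hxb n⟩⟩, μ k y), ?_, rfl⟩
    refine eventually_atTop.2 ⟨k, fun n hn => ⟨hx n hn, ?_⟩⟩
    change μ n (x n) = μ k y
    induction n, hn using Nat.le_induction with
    | base => rw [hxk]
    | succ n hn ih =>
      rw [hx n hn, ← ih]
      exact DFunLike.congr_fun (h.compat n) (x n)

theorem IsWeaklySemiprojective.exists_lift_subalgebras {C : Type u} [NonUnitalCStarAlgebra C]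
    (hC : IsWeaklySemiprojective C) {B : ℕ → Type u} [∀ k, NonUnitalCStarAlgebra (B k)]
    {A : Type u} [NonUnitalCStarAlgebra A] [SeparableSpace A]
    (ι : ∀ k, B k →⋆ₙₐ[ℂ] A) (hι : ∀ k, Function.Injective (ι k)) {s : Set A} (hs : Dense s)
    (hB : ∀ a ∈ s, ∃ b : ∀ k, B k, Tendsto (fun k => ι k (b k)) atTop (𝓝 a))
    (σ : C →⋆ₙₐ[ℂ] A) (F : Finset C) {ε : ℝ} (hε : 0 < ε) :
    ∀ᶠ n in atTop, ∃ ψ : C →⋆ₙₐ[ℂ] B n,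
      ∀ c ∈ F, ‖ι n (ψ c) - σ c‖ < ε ∧ ‖ψ c‖ < ‖σ c‖ + ε := by
  let Q : NonUnitalStarSubalgebra ℂ (lp B ∞ × A) :=
    { carrier := {x | Tendsto (fun n => ι n (x.1 n)) atTop (𝓝 x.2)}
      zero_mem' := by simp
      add_mem' := fun hx hy => (hx.add hy).congr fun n => by simp
      mul_mem' := fun hx hy => (hx.mul hy).congr fun n => by simp
      smul_mem' := fun c x hx => (hx.const_smul c).congr fun n => by simp
      star_mem' := fun hx => hx.star.congr fun n => by simp [map_star] }
  have memQ : ∀ x, x ∈ Q ↔ Tendsto (fun n => ι n (x.1 n)) atTop (𝓝 x.2) := fun _ => Iff.rfl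
  refine (hC.exists_lift ι Q ?_ ?_ (fun x hx => hx) ?_ σ F hε).mono
    fun n ⟨ψ, _, hψ⟩ => ⟨ψ, hψ⟩
  · intro k x hx
    rw [memQ] at hx ⊢
    refine hx.congr' ?_
    filter_upwards [eventually_ge_atTop k] with n hn
    rw [truncPair_fst, truncSeq_apply, if_neg (by omega)]
  · intro x hx ε hε
    have ht := ((memQ x).1 hx).norm.eventually_lt_const (lt_add_of_pos_right _ hε)
    filter_upwards [ht] with n hn
    rw [NonUnitalStarAlgHom.norm_map (ι n) (hι n)] at hn
    exact hn.le
  · refine hs.mono fun a ha => ?_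
    obtain ⟨b, hb⟩ := hB a ha
    refine ⟨(⟨b, memℓp_infty ?_⟩, a), hb, rfl⟩
    convert! hb.norm.bddAbove_range using 2
    ext n
    exact (NonUnitalStarAlgHom.norm_map (ι n) (hι n) _).symm

/-- The approximation property behind the one-sided approximate intertwining: morphisms from
members of the family into `A` approximately factor through arbitrarily large members. -/
theorem exists_approx_factorization
    {I : Type v} {Cfam : I → Type u} [∀ i, NonUnitalCStarAlgebra (Cfam i)]
    (hwsp : ∀ i, IsWeaklySemiprojective (Cfam i))
    {A : Type u} [NonUnitalCStarAlgebra A] [SeparableSpace A]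
    (h : ∀ (F : Finset A) (ε : ℝ), 0 < ε →
      ∃ (B : Type u) (_ : NonUnitalCStarAlgebra B) (ι : B →⋆ₙₐ[ℂ] A),
        Function.Injective ι ∧ EpsContained ε ↑F (Set.range ι) ∧
        ∃ (idx : ℕ → I) (γ : ∀ k, Cfam (idx k) →⋆ₙₐ[ℂ] Cfam (idx (k + 1)))
          (μ : ∀ k, Cfam (idx k) →⋆ₙₐ[ℂ] B), IsInductiveLimit γ B μ)
    {i : I} (σ : Cfam i →⋆ₙₐ[ℂ] A) (F : Finset (Cfam i)) (G : Finset A) {ε : ℝ} (hε : 0 < ε) :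
    ∃ (j : I) (σ' : Cfam j →⋆ₙₐ[ℂ] A) (ψ : Cfam i →⋆ₙₐ[ℂ] Cfam j),
      IsSeparable (Set.range ψ) ∧
      (∀ c ∈ F, ‖σ' (ψ c) - σ c‖ < ε ∧ ‖ψ c‖ < ‖σ c‖ + ε) ∧
      ∀ a ∈ G, ∃ y, ‖a - σ' y‖ < ε := by
  classical
  choose B instB ι hι hB idx γ μ hμ using fun n : ℕ =>
    h ((Finset.range (n + 1)).image (denseSeq A) ∪ G) (1 / ((n : ℝ) + 1)) Nat.one_div_pos_of_nat
  have happ : ∀ a ∈ Set.range (denseSeq A),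
      ∃ b : ∀ k, B k, Tendsto (fun k => ι k (b k)) atTop (𝓝 a) := by
    rintro _ ⟨l, rfl⟩
    have : ∀ n, ∃ b : B n, l ≤ n → ‖denseSeq A l - ι n b‖ < 1 / ((n : ℝ) + 1) := by
      intro n
      by_cases hn : l ≤ n
      · obtain ⟨_, ⟨b, rfl⟩, hb⟩ := hB n (denseSeq A l) (by
          simp only [Finset.coe_union, Finset.coe_image, Finset.coe_range]
          exact Or.inl ⟨l, Nat.lt_succ_of_le hn, rfl⟩)
        exact ⟨b, fun _ => hb⟩
      · exact ⟨0, fun h => absurd h hn⟩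
    choose b hb using this
    refine ⟨b, tendsto_iff_norm_sub_tendsto_zero.2 ?_⟩
    refine squeeze_zero' (Eventually.of_forall fun _ => norm_nonneg _) ?_
      (tendsto_one_div_add_atTop_nhds_zero_nat (𝕜 := ℝ))
    filter_upwards [eventually_ge_atTop l] with n hn
    rw [norm_sub_rev]
    exact (hb n hn).le
  obtain ⟨n, ⟨ψ₁, hψ₁⟩, hn⟩ := (((hwsp i).exists_lift_subalgebras ι hι (denseRange_denseSeq A)
    happ σ F (half_pos hε)).and ((tendsto_one_div_add_atTop_nhds_zero_nat
      (𝕜 := ℝ)).eventually_lt_const (half_pos hε))).exists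
  have hiso := NonUnitalStarAlgHom.isometry (ι n) (hι n)
  have : SeparableSpace (B n) := by
    have := UniformSpace.secondCountable_of_separable A
    have := hiso.isUniformInducing.isInducing.secondCountableTopology
    infer_instance
  have hG : ∀ a ∈ G, ∀ᶠ m in atTop, ∃ y, ‖a - ι n (μ n m y)‖ < ε := by
    intro a ha
    obtain ⟨_, ⟨b, rfl⟩, hb⟩ := hB n a (by simp [ha])
    obtain ⟨z, hz, hbz⟩ := Metric.dense_iff.1 (hμ n).dense_union b (ε / 2) (half_pos hε)
    obtain ⟨k, hk⟩ := Set.mem_iUnion.1 hbz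
    filter_upwards [eventually_ge_atTop k] with m hm
    obtain ⟨y, rfl⟩ := (hμ n).range_mono hm hk
    refine ⟨y, ?_⟩
    have h1 : ‖ι n b - ι n (μ n m y)‖ < ε / 2 := by
      rw [← dist_eq_norm, hiso.dist_eq, dist_comm]
      exact hz
    have h2 := norm_sub_le_norm_sub_add_norm_sub a (ι n b) (ι n (μ n m y))
    linarith
  obtain ⟨m, ⟨ψ, hψs, hψ⟩, hm⟩ := (((hwsp i).exists_lift_inductiveLimit (hμ n) ψ₁ F
    (half_pos hε)).and ((Filter.eventually_all_finset G).2 hG)).exists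
  refine ⟨idx n m, (ι n).comp (μ n m), ψ, hψs, fun c hc => ?_, hm⟩
  obtain ⟨h1, h2⟩ := hψ₁ c hc
  obtain ⟨h3, h4⟩ := hψ c hc
  constructor
  · have h5 : ‖ι n (μ n m (ψ c)) - ι n (ψ₁ c)‖ < ε / 2 := by
      rwa [← dist_eq_norm, hiso.dist_eq, dist_eq_norm]
    have h6 := norm_sub_le_norm_sub_add_norm_sub (ι n (μ n m (ψ c))) (ι n (ψ₁ c)) (σ c)
    change ‖ι n (μ n m (ψ c)) - σ c‖ < ε
    linarith
  · linarith

end Lifting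

section Intertwining

open TopologicalSpace

/-- `z` is the orbit of `x : X k` under the connecting morphisms, from index `k` on. -/
def IsOrbit {X : ℕ → Type u} [∀ k, NonUnitalCStarAlgebra (X k)]
    (γ : ∀ k, X k →⋆ₙₐ[ℂ] X (k + 1)) (k : ℕ) (x : X k) (z : ∀ n, X n) : Prop :=
  z k = x ∧ ∀ n, k ≤ n → z (n + 1) = γ n (z n)

namespace IsOrbit

variable {X : ℕ → Type u} [∀ k, NonUnitalCStarAlgebra (X k)]
  {γ : ∀ k, X k →⋆ₙₐ[ℂ] X (k + 1)} {k : ℕ}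

theorem apply_add {x : X k} {z : ∀ n, X n} (hz : IsOrbit γ k x z) (n : ℕ) :
    z (k + n) = iterHom γ k n x := by
  induction n with
  | zero => exact hz.1
  | succ n ih =>
    change z (k + n + 1) = γ (k + n) (iterHom γ k n x)
    rw [← ih]
    exact hz.2 _ (by omega)

theorem succ {x : X k} {z : ∀ n, X n} (hz : IsOrbit γ k x z) :
    IsOrbit γ (k + 1) (γ k x) z :=
  ⟨by rw [hz.2 k le_rfl, hz.1], fun n hn => hz.2 n (by omega)⟩

theorem norm_sub_le {x y : X k} {z w : ∀ n, X n} (hz : IsOrbit γ k x z)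
    (hw : IsOrbit γ k y w) {n : ℕ} (hn : k ≤ n) : ‖z n - w n‖ ≤ ‖x - y‖ := by
  induction n, hn using Nat.le_induction with
  | base => rw [hz.1, hw.1]
  | succ n hn ih =>
    rw [hz.2 n hn, hw.2 n hn, ← map_sub]
    exact (NonUnitalStarAlgHom.norm_apply_le _ _).trans ih

theorem zero : IsOrbit γ k 0 0 := ⟨rfl, fun n _ => (map_zero (γ n)).symm⟩

theorem add {x y : X k} {z w : ∀ n, X n} (hz : IsOrbit γ k x z) (hw : IsOrbit γ k y w) :
    IsOrbit γ k (x + y) (z + w) :=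
  ⟨by simp [hz.1, hw.1], fun n hn => by simp [hz.2 n hn, hw.2 n hn]⟩

theorem mul {x y : X k} {z w : ∀ n, X n} (hz : IsOrbit γ k x z) (hw : IsOrbit γ k y w) :
    IsOrbit γ k (x * y) (z * w) :=
  ⟨by simp [hz.1, hw.1], fun n hn => by simp [hz.2 n hn, hw.2 n hn]⟩

theorem smul {x : X k} {z : ∀ n, X n} (c : ℂ) (hz : IsOrbit γ k x z) :
    IsOrbit γ k (c • x) (c • z) :=
  ⟨by simp [hz.1], fun n hn => by simp [hz.2 n hn]⟩

theorem star {x : X k} {z : ∀ n, X n} (hz : IsOrbit γ k x z) :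
    IsOrbit γ k (Star.star x) (Star.star z) :=
  ⟨by simp [hz.1], fun n hn => by simp [hz.2 n hn, map_star]⟩

end IsOrbit

/-- If the images of all orbits are Cauchy sequences, the
pointwise limits of the maps `σ n` along the system are *-homomorphisms. -/
theorem exists_limit_morphisms {X : ℕ → Type u} [∀ k, NonUnitalCStarAlgebra (X k)]
    (γ : ∀ k, X k →⋆ₙₐ[ℂ] X (k + 1)) {A : Type v} [NonUnitalCStarAlgebra A]
    (σ : ∀ n, X n →⋆ₙₐ[ℂ] A)
    (hσ : ∀ k (x : X k) z, IsOrbit γ k x z → CauchySeq fun n => σ n (z n)) :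
    ∃ μ : ∀ k, X k →⋆ₙₐ[ℂ] A, (∀ k, (μ (k + 1)).comp (γ k) = μ k) ∧
      ∀ k (x : X k) z, IsOrbit γ k x z → Tendsto (fun n => σ n (z n)) atTop (𝓝 (μ k x)) := by
  have hex : ∀ k (x : X k), ∃ z, IsOrbit γ k x z := fun k x =>
    let ⟨z, _, hz⟩ := exists_coherent_seq γ k x
    ⟨z, hz⟩
  have hlim : ∀ k (x : X k), ∃ a, ∀ z, IsOrbit γ k x z →
      Tendsto (fun n => σ n (z n)) atTop (𝓝 a) := by
    intro k x
    obtain ⟨z, hz⟩ := hex k x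
    obtain ⟨a, ha⟩ := cauchySeq_tendsto_of_complete (hσ k x z hz)
    refine ⟨a, fun w hw => ha.congr' ?_⟩
    filter_upwards [eventually_ge_atTop k] with n hn
    have := hz.norm_sub_le hw hn
    rw [sub_self, norm_zero, norm_le_zero_iff, sub_eq_zero] at this
    rw [this]
  choose m hm using hlim
  choose z hz using hex
  refine ⟨fun k =>
    { toFun := m k
      map_smul' := fun c x => tendsto_nhds_unique (hm k _ _ ((hz k x).smul c)) (by
        simpa using (hm k x _ (hz k x)).const_smul c)
      map_zero' := tendsto_nhds_unique (hm k _ _ IsOrbit.zero) (by simp)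
      map_add' := fun x y => tendsto_nhds_unique (hm k _ _ ((hz k x).add (hz k y))) (by
        simpa using (hm k x _ (hz k x)).add (hm k y _ (hz k y)))
      map_mul' := fun x y => tendsto_nhds_unique (hm k _ _ ((hz k x).mul (hz k y))) (by
        simpa using (hm k x _ (hz k x)).mul (hm k y _ (hz k y)))
      map_star' := fun x => tendsto_nhds_unique (hm k _ _ (hz k x).star) (by
        simpa [map_star] using (hm k x _ (hz k x)).star) }, fun k => ?_, hm⟩
  ext x
  exact tendsto_nhds_unique (hm (k + 1) _ _ (hz k x).succ) (hm k x _ (hz k x))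

/-- One-sided approximate intertwining. The rows `e n k` with `k < n` are dense in the images
of the connecting morphisms, and `σ (n + 1) ∘ γ n` approximates `σ n` on the first elements
of each of them. -/
theorem exists_isInductiveLimit_of_approx {X : ℕ → Type u} [∀ k, NonUnitalCStarAlgebra (X k)]
    {γ : ∀ k, X k →⋆ₙₐ[ℂ] X (k + 1)} {A : Type v} [NonUnitalCStarAlgebra A]
    {σ : ∀ n, X n →⋆ₙₐ[ℂ] A} {a : ℕ → A} (ha : DenseRange a) {e : ∀ n, ℕ → ℕ → X n}
    (hσ : ∀ n, ∀ k ≤ n, ∀ l ≤ n,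
      ‖σ (n + 1) (γ n (e n k l)) - σ n (e n k l)‖ ≤ (1 / 2) ^ n ∧
      ‖γ n (e n k l)‖ ≤ ‖σ n (e n k l)‖ + (1 / 2) ^ n)
    (hea : ∀ n, ∀ l ≤ n, ‖a l - σ (n + 1) (e (n + 1) n l)‖ ≤ (1 / 2) ^ n)
    (hed : ∀ n x, ∀ ε : ℝ, 0 < ε → ∃ l, ‖γ n x - e (n + 1) n l‖ < ε)
    (hes : ∀ n k l, k ≠ n → e (n + 1) k l = γ n (e n k l)) :
    ∃ μ : ∀ k, X k →⋆ₙₐ[ℂ] A, IsInductiveLimit γ A μ := by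
  have horb : ∀ k l, IsOrbit γ (k + 1) (e (k + 1) k l) fun n => e n k l :=
    fun k l => ⟨rfl, fun n hn => hes n k l (by omega)⟩
  have hstep : ∀ k l n, k < n → l ≤ n →
      ‖σ (n + 1) (e (n + 1) k l) - σ n (e n k l)‖ ≤ (1 / 2) ^ n ∧
      ‖e (n + 1) k l‖ ≤ ‖σ n (e n k l)‖ + (1 / 2) ^ n := by
    intro k l n hk hl
    rw [hes n k l hk.ne]
    exact hσ n k hk.le l hl
  have hcau : ∀ k l, CauchySeq fun n => σ n (e n k l) := by
    intro k l
    rw [← cauchySeq_shift (k + 1 + l)]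
    refine cauchySeq_of_le_geometric (1 / 2) 1 (by norm_num) fun n => ?_
    rw [dist_comm, dist_eq_norm, one_mul, add_right_comm n 1]
    refine (hstep k l (n + (k + 1 + l)) (by omega) (by omega)).1.trans ?_
    exact pow_le_pow_of_le_one (by norm_num) (by norm_num) (by omega)
  have happ : ∀ k (x : X k) z, IsOrbit γ k x z → ∀ δ : ℝ, 0 < δ →
      ∃ l, ∀ n, k < n → ‖z n - e n k l‖ < δ := by
    intro k x z hz δ hδ
    obtain ⟨l, hl⟩ := hed k x δ hδ
    exact ⟨l, fun n hn => (hz.succ.norm_sub_le (horb k l) hn).trans_lt hl⟩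
  obtain ⟨μ, hμγ, hμ⟩ := exists_limit_morphisms γ σ (by
    intro k x z hz
    rw [Metric.cauchySeq_iff']
    intro ε hε
    obtain ⟨l, hl⟩ := happ k x z hz (ε / 3) (by positivity)
    obtain ⟨N, hN⟩ := Metric.cauchySeq_iff.1 (hcau k l) (ε / 3) (by positivity)
    refine ⟨max N (k + 1), fun n hn => ?_⟩
    have hσl : ∀ n, k < n → dist (σ n (z n)) (σ n (e n k l)) < ε / 3 := by
      intro n hn
      rw [dist_eq_norm, ← map_sub]
      exact (NonUnitalStarAlgHom.norm_apply_le _ _).trans_lt (hl n hn)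
    have h1 := hσl n (by omega)
    have h2 := hσl (max N (k + 1)) (by omega)
    have h3 := hN n (by omega) (max N (k + 1)) (by omega)
    rw [dist_comm] at h2
    refine (dist_triangle4 _ _ _ _).trans_lt ((add_lt_add (add_lt_add h1 h3) h2).trans_eq ?_)
    ring)
  refine ⟨μ, hμγ, ?_, ?_⟩
  · refine Metric.dense_iff.2 fun b ε hε => ?_
    obtain ⟨_, hb, l, rfl⟩ := Metric.dense_iff.1 ha b (ε / 2) (half_pos hε)
    obtain ⟨N, hN⟩ := exists_pow_lt_of_lt_one (show 0 < ε / 4 by positivity)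
      (show (1 / 2 : ℝ) < 1 by norm_num)
    set n := max N l
    have hn : (1 / 2 : ℝ) ^ n < ε / 4 :=
      (pow_le_pow_of_le_one (by norm_num) (by norm_num) (le_max_left N l)).trans_lt hN
    refine ⟨μ (n + 1) (e (n + 1) n l), ?_, Set.mem_iUnion.2 ⟨_, _, rfl⟩⟩
    have key : ∀ m, n + 1 ≤ m →
        ‖a l - σ m (e m n l)‖ ≤ 2 * (1 / 2) ^ n - 2 * (1 / 2) ^ m := by
      intro m hm
      induction m, hm using Nat.le_induction with
      | base =>
        refine (hea n l (le_max_right N l)).trans_eq ?_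
        rw [pow_succ]; ring
      | succ m hm ih =>
        have h1 := (hstep n l m (by omega) ((le_max_right N l).trans (by omega))).1
        have h2 := norm_sub_le_norm_sub_add_norm_sub (a l) (σ m (e m n l))
          (σ (m + 1) (e (m + 1) n l))
        rw [norm_sub_rev (σ m (e m n l))] at h2
        rw [pow_succ]
        linarith
    have hle : ‖a l - μ (n + 1) (e (n + 1) n l)‖ ≤ 2 * (1 / 2) ^ n := by
      refine le_of_tendsto (tendsto_const_nhds.sub (hμ _ _ _ (horb n l))).norm ?_
      filter_upwards [eventually_ge_atTop (n + 1)] with m hm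
      have : (0 : ℝ) < (1 / 2) ^ m := by positivity
      linarith [key m hm]
    rw [Metric.mem_ball] at hb ⊢
    rw [← dist_eq_norm, dist_comm] at hle
    linarith [dist_triangle (μ (n + 1) (e (n + 1) n l)) (a l) b]
  · intro k x
    obtain ⟨z, -, hz⟩ := exists_coherent_seq γ k x
    have hz' : IsOrbit γ k x z := hz
    have hnorm := (hμ k x z hz').norm
    have hgoal : Tendsto (fun n => ‖z n‖) atTop (𝓝 ‖μ k x‖) := by
      rw [← tendsto_add_atTop_iff_nat 1, Metric.tendsto_atTop']
      intro ε hε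
      obtain ⟨l, hl⟩ := happ k x z hz' (ε / 4) (by positivity)
      obtain ⟨N, hN⟩ := Metric.tendsto_atTop.1 hnorm (ε / 4) (by positivity)
      obtain ⟨M, hM⟩ := exists_pow_lt_of_lt_one (show 0 < ε / 4 by positivity)
        (show (1 / 2 : ℝ) < 1 by norm_num)
      refine ⟨N + M + k + l, fun n hn => ?_⟩
      have hpow : (1 / 2 : ℝ) ^ n < ε / 4 :=
        (pow_le_pow_of_le_one (by norm_num) (by norm_num) (by omega)).trans_lt hM
      have h1 := hl n (by omega)
      have h2 := hl (n + 1) (by omega)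
      have h3 := (hstep k l n (by omega) (by omega)).2
      have h4 := abs_lt.1 (hN n (by omega))
      have h5 := abs_lt.1 (hN (n + 1) (by omega))
      have h6 : ‖σ n (z n) - σ n (e n k l)‖ < ε / 4 := by
        rw [← map_sub]
        exact (NonUnitalStarAlgHom.norm_apply_le _ _).trans_lt h1
      have h7 := norm_sub_norm_le (σ n (e n k l)) (σ n (z n))
      rw [norm_sub_rev] at h7
      have h8 := norm_sub_norm_le (z (n + 1)) (e (n + 1) k l)
      have h9 := NonUnitalStarAlgHom.norm_apply_le (σ (n + 1)) (z (n + 1))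
      rw [Real.dist_eq, abs_lt]
      constructor <;> linarith
    refine ((tendsto_add_atTop_iff_nat k).2 hgoal).congr fun n => ?_
    rw [add_comm, hz'.apply_add]

/-- The data at one stage of the construction of an inductive system: a member of the family,
a morphism into `A`, and a double sequence of marked elements. -/
structure MarkedMorphism {I : Type v} (Cfam : I → Type u) [∀ i, NonUnitalCStarAlgebra (Cfam i)]
    (A : Type u) [NonUnitalCStarAlgebra A] where
  idx : I
  hom : Cfam idx →⋆ₙₐ[ℂ] A
  mark : ℕ → ℕ → Cfam idx

theorem exists_next_markedMorphism
    {I : Type v} {Cfam : I → Type u} [∀ i, NonUnitalCStarAlgebra (Cfam i)]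
    {A : Type u} [NonUnitalCStarAlgebra A] (a : ℕ → A)
    (h : ∀ (i : I) (σ : Cfam i →⋆ₙₐ[ℂ] A) (F : Finset (Cfam i)) (G : Finset A) (ε : ℝ), 0 < ε →
      ∃ (j : I) (σ' : Cfam j →⋆ₙₐ[ℂ] A) (ψ : Cfam i →⋆ₙₐ[ℂ] Cfam j),
        IsSeparable (Set.range ψ) ∧
        (∀ c ∈ F, ‖σ' (ψ c) - σ c‖ < ε ∧ ‖ψ c‖ < ‖σ c‖ + ε) ∧
        ∀ a ∈ G, ∃ y, ‖a - σ' y‖ < ε)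
    (n : ℕ) (s : MarkedMorphism Cfam A) :
    ∃ (t : MarkedMorphism Cfam A) (γ : Cfam s.idx →⋆ₙₐ[ℂ] Cfam t.idx),
      (∀ k ≤ n, ∀ l ≤ n,
        ‖t.hom (γ (s.mark k l)) - s.hom (s.mark k l)‖ ≤ (1 / 2) ^ n ∧
        ‖γ (s.mark k l)‖ ≤ ‖s.hom (s.mark k l)‖ + (1 / 2) ^ n) ∧
      (∀ l ≤ n, ‖a l - t.hom (t.mark n l)‖ ≤ (1 / 2) ^ n) ∧
      (∀ x, ∀ ε : ℝ, 0 < ε → ∃ l, ‖γ x - t.mark n l‖ < ε) ∧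
      ∀ k l, k ≠ n → t.mark k l = γ (s.mark k l) := by
  classical
  obtain ⟨j, σ, ψ, ⟨c, hc, hψc⟩, hF, hG⟩ := h s.idx s.hom
    ((Finset.range (n + 1) ×ˢ Finset.range (n + 1)).image fun p => s.mark p.1 p.2)
    ((Finset.range (n + 1)).image a) ((1 / 2) ^ n) (by positivity)
  have hne : c.Nonempty := by
    rw [← closure_nonempty_iff]
    exact ⟨_, hψc ⟨0, rfl⟩⟩
  obtain ⟨d, rfl⟩ := hc.exists_eq_range hne
  have hy : ∀ l, ∃ y, l ≤ n → ‖a l - σ y‖ < (1 / 2) ^ n := by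
    intro l
    by_cases hl : l ≤ n
    · obtain ⟨y, hy⟩ := hG (a l) (Finset.mem_image_of_mem a (by simpa [Nat.lt_succ_iff] using hl))
      exact ⟨y, fun _ => hy⟩
    · exact ⟨0, fun h => absurd h hl⟩
  choose y hy using hy
  refine ⟨⟨j, σ, Function.update (fun k l => ψ (s.mark k l)) n
    fun l => if l ≤ n then y l else d (l - (n + 1))⟩, ψ, ?_, ?_, ?_, ?_⟩
  · intro k hk l hl
    obtain ⟨h1, h2⟩ := hF (s.mark k l) (Finset.mem_image.2
      ⟨(k, l), by simpa [Nat.lt_succ_iff] using ⟨hk, hl⟩, rfl⟩)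
    exact ⟨h1.le, h2.le⟩
  · intro l hl
    simpa [hl] using (hy l hl).le
  · intro x ε hε
    obtain ⟨_, ⟨l, rfl⟩, hl⟩ := Metric.mem_closure_iff.1 (hψc ⟨x, rfl⟩) ε hε
    refine ⟨l + (n + 1), ?_⟩
    rw [dist_eq_norm] at hl
    simpa [show ¬ l + (n + 1) ≤ n by omega] using hl
  · intro k l hk
    simp [hk]

end Intertwining

open TopologicalSpace in
/-- Criterion "A𝒞-like implies A𝒞": if a separable C*-algebra `A` is approximated by
sub-C*-algebras that are inductive limits of algebras from a family `(C_i)` of weakly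
semiprojective C*-algebras, then `A` is itself an inductive limit of algebras from the
family. -/
theorem ACLike_implies_AC
    {I : Type v} (Cfam : I → Type u) [∀ i, NonUnitalCStarAlgebra (Cfam i)]
    (hwsp : ∀ i, IsWeaklySemiprojective (Cfam i))
    (A : Type u) [NonUnitalCStarAlgebra A] [SeparableSpace A]
    (h : ∀ (F : Finset A) (ε : ℝ), 0 < ε →
      ∃ (B : Type u) (_ : NonUnitalCStarAlgebra B) (ι : B →⋆ₙₐ[ℂ] A),
        Function.Injective ι ∧ EpsContained ε ↑F (Set.range ι) ∧
        ∃ (idx : ℕ → I) (γ : ∀ k, Cfam (idx k) →⋆ₙₐ[ℂ] Cfam (idx (k + 1)))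
          (μ : ∀ k, Cfam (idx k) →⋆ₙₐ[ℂ] B), IsInductiveLimit γ B μ) :
    ∃ (idx : ℕ → I) (γ : ∀ k, Cfam (idx k) →⋆ₙₐ[ℂ] Cfam (idx (k + 1)))
      (μ : ∀ k, Cfam (idx k) →⋆ₙₐ[ℂ] A), IsInductiveLimit γ A μ := by
  choose next γ hγ using exists_next_markedMorphism (denseSeq A)
    fun _ σ F G _ hε => exists_approx_factorization hwsp h σ F G hε
  obtain ⟨_, _, _, _, _, idx, _⟩ := h ∅ 1 one_pos
  let s : ℕ → MarkedMorphism Cfam A := fun n => Nat.rec ⟨idx 0, 0, 0⟩ next n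
  obtain ⟨μ, hμ⟩ := exists_isInductiveLimit_of_approx (X := fun n => Cfam (s n).idx)
    (γ := fun n => γ n (s n)) (σ := fun n => (s n).hom) (denseRange_denseSeq A)
    (e := fun n => (s n).mark) (fun n => (hγ n (s n)).1) (fun n => (hγ n (s n)).2.1)
    (fun n => (hγ n (s n)).2.2.1) (fun n => (hγ n (s n)).2.2.2)
  exact ⟨_, _, μ, hμ⟩
end

section
/- (Loring's local test for inductive limits.) Let (C_i)_{i∈I} be a family of weakly semiprojective C*-algebras and let A be a separable C*-algebra. Suppose that for every finite subset F ⊆ A and every ε > 0 there exists a sub-C*-algebra B ⊆ A with F ⊂_ε B such that B is isomorphic to C_i for some i ∈ I. Then A is isomorphic to the inductive limit of an inductive system all of whose terms belong to the family (C_i)_{i∈I}. -/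
open Filter Topology Set

noncomputable section

section ConvergentSequences

open OnePoint

variable {A : Type u} [NonUnitalCStarAlgebra A]

/-- The algebra of convergent sequences in `A` whose `n`-th term lies in `R (k + n)`. -/
def convergentSeq (R : ℕ → NonUnitalStarSubalgebra ℂ A) (k : ℕ) :
    NonUnitalStarSubalgebra ℂ C(OnePoint ℕ, A) where
  carrier := {f | ∀ n : ℕ, f (n : OnePoint ℕ) ∈ R (k + n)}
  zero_mem' n := zero_mem (R (k + n))
  add_mem' hf hg n := add_mem (hf n) (hg n)
  mul_mem' hf hg n := mul_mem (hf n) (hg n)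
  smul_mem' c _ hf n := SMulMemClass.smul_mem c (hf n)
  star_mem' hf n := star_mem (hf n)

theorem isClosed_convergentSeq {R : ℕ → NonUnitalStarSubalgebra ℂ A}
    (hR : ∀ n, IsClosed (R n : Set A)) (k : ℕ) :
    IsClosed (convergentSeq R k : Set C(OnePoint ℕ, A)) := by
  have : (convergentSeq R k : Set C(OnePoint ℕ, A)) =
      ⋂ n : ℕ, (fun f : C(OnePoint ℕ, A) => f (n : OnePoint ℕ)) ⁻¹' (R (k + n) : Set A) := by
    ext f
    simp only [mem_iInter]
    rfl
  rw [this]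
  exact isClosed_iInter fun n =>
    (hR (k + n)).preimage (continuous_eval_const (n : OnePoint ℕ))

/-- The successor map on `ℕ ∪ {∞}`. -/
def onePointSucc : C(OnePoint ℕ, OnePoint ℕ) :=
  continuousMapMkNat (fun n => ((n + 1 : ℕ) : OnePoint ℕ)) ∞ <| by
    have h := (OnePoint.continuous_iff_from_nat (id : OnePoint ℕ → OnePoint ℕ)).1 continuous_id
    exact h.comp (tendsto_add_atTop_nat 1)

/-- Dropping the first term of a convergent sequence. -/
def convergentSeqShift (R : ℕ → NonUnitalStarSubalgebra ℂ A) (k : ℕ) :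
    convergentSeq R k →⋆ₙₐ[ℂ] convergentSeq R (k + 1) where
  toFun f := ⟨f.1.comp onePointSucc, fun n => by
    have := f.2 (n + 1)
    rwa [← add_assoc, add_right_comm] at this⟩
  map_smul' _ _ := rfl
  map_zero' := rfl
  map_add' _ _ := rfl
  map_mul' _ _ := rfl
  map_star' _ := rfl

/-- The limit of a convergent sequence. -/
def convergentSeqLim (R : ℕ → NonUnitalStarSubalgebra ℂ A) (k : ℕ) :
    convergentSeq R k →⋆ₙₐ[ℂ] A where
  toFun f := f.1 ∞
  map_smul' _ _ := rfl
  map_zero' := rfl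
  map_add' _ _ := rfl
  map_mul' _ _ := rfl
  map_star' _ := rfl

/-- The terms of a convergent sequence. -/
def convergentSeqEval (R : ℕ → NonUnitalStarSubalgebra ℂ A) (k n : ℕ) :
    convergentSeq R k →⋆ₙₐ[ℂ] R (k + n) where
  toFun f := ⟨f.1 (n : OnePoint ℕ), f.2 n⟩
  map_smul' _ _ := rfl
  map_zero' := rfl
  map_add' _ _ := rfl
  map_mul' _ _ := rfl
  map_star' _ := rfl

theorem tendsto_convergentSeqEval (R : ℕ → NonUnitalStarSubalgebra ℂ A) (k : ℕ)
    (f : convergentSeq R k) :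
    Tendsto (fun n => (convergentSeqEval R k n f : A)) atTop (𝓝 (convergentSeqLim R k f)) :=
  (OnePoint.continuous_iff_from_nat f.1).1 f.1.continuous

theorem convergentSeqShift_surjective (R : ℕ → NonUnitalStarSubalgebra ℂ A) (k : ℕ) :
    Function.Surjective (convergentSeqShift R k) := by
  intro g
  have hg := (OnePoint.continuous_iff_from_nat g.1).1 g.1.continuous
  let f : ℕ → A := fun n => Nat.casesOn n 0 fun m => g.1 (m : OnePoint ℕ)
  have hf : Tendsto f atTop (𝓝 (g.1 ∞)) := (tendsto_add_atTop_iff_nat 1).1 hg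
  refine ⟨⟨continuousMapMkNat f (g.1 ∞) hf, fun n => ?_⟩, ?_⟩
  · cases n with
    | zero => exact zero_mem (R k)
    | succ m =>
      have := g.2 m
      rwa [add_right_comm, add_assoc] at this
  · refine Subtype.ext (ContinuousMap.ext fun x => ?_)
    induction x using OnePoint.rec with
    | infty => rfl
    | coe n => rfl

theorem isInductiveLimit_convergentSeq {R : ℕ → NonUnitalStarSubalgebra ℂ A}
    (hR : ∀ n, IsClosed (R n : Set A))
    (happrox : ∀ a : A, ∃ b : ℕ → A, (∀ n, b n ∈ R n) ∧ Tendsto b atTop (𝓝 a)) :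
    haveI : ∀ k, IsClosed (convergentSeq R k : Set C(OnePoint ℕ, A)) := isClosed_convergentSeq hR
    IsInductiveLimit (A := fun k => convergentSeq R k) (convergentSeqShift R) A
      (convergentSeqLim R) := by
  have : ∀ k, IsClosed (convergentSeq R k : Set C(OnePoint ℕ, A)) := isClosed_convergentSeq hR
  refine ⟨fun _ => rfl, ?_, fun k f => ?_⟩
  · convert dense_univ
    refine eq_univ_of_forall fun a => mem_iUnion.2 ⟨0, ?_⟩
    obtain ⟨b, hb, hba⟩ := happrox a
    refine ⟨⟨continuousMapMkNat b a hba, fun n => ?_⟩, rfl⟩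
    rw [zero_add]
    exact hb n
  · have hcoe : ∀ n m : ℕ, (iterHom (A := fun k => convergentSeq R k)
        (convergentSeqShift R) k n f).1 (m : OnePoint ℕ) = f.1 ((m + n : ℕ) : OnePoint ℕ) := by
      intro n
      induction n with
      | zero => exact fun m => rfl
      | succ n ih =>
        intro m
        have := ih (m + 1)
        rwa [add_assoc, add_comm 1] at this
    have hinf : ∀ n : ℕ, (iterHom (A := fun k => convergentSeq R k)
        (convergentSeqShift R) k n f).1 ∞ = f.1 ∞ := by
      intro n
      induction n with
      | zero => rfl
      | succ n ih => exact ih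
    have hf : Tendsto (fun n : ℕ => f.1 (n : OnePoint ℕ)) atTop (𝓝 (f.1 ∞)) :=
      (OnePoint.continuous_iff_from_nat f.1).1 f.1.continuous
    refine Metric.tendsto_atTop.2 fun ε hε => ?_
    obtain ⟨N, hN⟩ := Metric.tendsto_atTop.1 hf.norm (ε / 2) (half_pos hε)
    refine ⟨N, fun n hn => ?_⟩
    have hlow : ‖f.1 ∞‖ ≤ ‖(iterHom (A := fun k => convergentSeq R k)
        (convergentSeqShift R) k n f).1‖ := by
      rw [← hinf n]
      exact ContinuousMap.norm_coe_le_norm _ _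
    have hupp : ‖(iterHom (A := fun k => convergentSeq R k)
        (convergentSeqShift R) k n f).1‖ ≤ ‖f.1 ∞‖ + ε / 2 := by
      refine (ContinuousMap.norm_le _ (by positivity)).2 fun x => ?_
      induction x using OnePoint.rec with
      | infty =>
        rw [hinf n]
        linarith
      | coe m =>
        rw [hcoe n m]
        have := abs_lt.1 (hN (m + n) (by omega))
        linarith [this.2]
    change |‖(iterHom (A := fun k => convergentSeq R k)
        (convergentSeqShift R) k n f).1‖ - ‖f.1 ∞‖| < ε
    rw [abs_lt]
    constructor <;> linarith

end ConvergentSequences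

section WeaklySemiprojective

/-- If `R n` are closed subalgebras of `A` eventually approximating each element of `A`, then
morphisms from a weakly semiprojective algebra to `A` can be approximately lifted into `R n` for
all large `n`. -/
theorem IsWeaklySemiprojective.eventually_lift {A C : Type u} [NonUnitalCStarAlgebra A]
    [NonUnitalCStarAlgebra C] (hC : IsWeaklySemiprojective C)
    {R : ℕ → NonUnitalStarSubalgebra ℂ A} (hR : ∀ n, IsClosed (R n : Set A))
    (happrox : ∀ a : A, ∃ b : ℕ → A, (∀ n, b n ∈ R n) ∧ Tendsto b atTop (𝓝 a))
    (φ : C →⋆ₙₐ[ℂ] A) (F : Finset C) {ε : ℝ} (hε : 0 < ε) :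
    ∀ᶠ n in atTop, ∃ ψ : C →⋆ₙₐ[ℂ] R n, ∀ x ∈ F, ‖(ψ x : A) - φ x‖ < ε := by
  have : ∀ k, IsClosed (convergentSeq R k : Set C(OnePoint ℕ, A)) := isClosed_convergentSeq hR
  obtain ⟨k, ψ, hψ⟩ := hC (fun k => convergentSeq R k) (convergentSeqShift R)
    (convergentSeqShift_surjective R) A (convergentSeqLim R)
    (isInductiveLimit_convergentSeq hR happrox) φ ε hε F
  have hev : ∀ᶠ n in atTop, ∀ x ∈ F, ‖(convergentSeqEval R k n (ψ x) : A) - φ x‖ < ε := by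
    refine (Filter.eventually_all_finset F).2 fun x hx => ?_
    exact ((tendsto_convergentSeqEval R k (ψ x)).sub_const (φ x)).norm.eventually_lt_const
      (hψ x hx)
  obtain ⟨N, hN⟩ := eventually_atTop.1 hev
  refine eventually_atTop.2 ⟨k + N, fun n hn => ?_⟩
  obtain ⟨m, rfl⟩ := Nat.exists_eq_add_of_le hn
  rw [add_assoc]
  exact ⟨(convergentSeqEval R k (N + m)).comp ψ, hN (N + m) (Nat.le_add_right _ _)⟩

open TopologicalSpace in
/-- A morphism from a weakly semiprojective algebra into `A` approximately factors through members
of any family of algebras locally approximating the separable algebra `A`. -/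
theorem IsWeaklySemiprojective.exists_approx_factor {I : Type v} {Cfam : I → Type u}
    [∀ i, NonUnitalCStarAlgebra (Cfam i)] {A C : Type u} [NonUnitalCStarAlgebra A]
    [SeparableSpace A] [NonUnitalCStarAlgebra C]
    (h : ∀ (F : Finset A) (ε : ℝ), 0 < ε → ∃ (i : I) (ι : Cfam i →⋆ₙₐ[ℂ] A),
      Function.Injective ι ∧ EpsContained ε ↑F (Set.range ι))
    (hC : IsWeaklySemiprojective C) (φ : C →⋆ₙₐ[ℂ] A) (F : Finset C) (G : Finset A)
    {ε : ℝ} (hε : 0 < ε) :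
    ∃ (i : I) (ι : Cfam i →⋆ₙₐ[ℂ] A) (ψ : C →⋆ₙₐ[ℂ] Cfam i), Function.Injective ι ∧
      EpsContained ε ↑G (Set.range ι) ∧ ∀ x ∈ F, ‖ι (ψ x) - φ x‖ < ε := by
  classical
  choose i ι hinj happ using fun n : ℕ =>
    h (G ∪ (Finset.range (n + 1)).image (denseSeq A)) (1 / ((n : ℝ) + 1)) Nat.one_div_pos_of_nat
  have hiso : ∀ n, Isometry (ι n) := fun n => NonUnitalStarAlgHom.isometry (ι n) (hinj n)
  let R : ℕ → NonUnitalStarSubalgebra ℂ A := fun n => NonUnitalStarAlgHom.range (ι n)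
  have hRcoe : ∀ n, (R n : Set A) = Set.range (ι n) := fun n => NonUnitalStarAlgHom.coe_range _
  have hR : ∀ n, IsClosed (R n : Set A) := fun n => by
    rw [hRcoe n]
    exact (hiso n).isClosedEmbedding.isClosed_range
  have happrox : ∀ a : A, ∃ b : ℕ → A, (∀ n, b n ∈ R n) ∧ Tendsto b atTop (𝓝 a) := by
    intro a
    have hne : ∀ n, (R n : Set A).Nonempty := fun n => ⟨0, zero_mem (R n)⟩
    have hsel : ∀ n : ℕ, ∃ b ∈ R n,
        dist a b < Metric.infDist a (R n : Set A) + 1 / ((n : ℝ) + 1) := fun n =>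
      (Metric.infDist_lt_iff (hne n)).1 (lt_add_of_pos_right _ Nat.one_div_pos_of_nat)
    choose b hb hab using hsel
    refine ⟨b, hb, Metric.tendsto_atTop.2 fun δ hδ => ?_⟩
    obtain ⟨_, hj, ⟨j, rfl⟩⟩ :=
      Metric.dense_iff.1 (denseRange_denseSeq A) a (δ / 3) (by positivity)
    obtain ⟨N, hN⟩ := exists_nat_one_div_lt (show (0 : ℝ) < δ / 3 by positivity)
    refine ⟨max j N, fun n hn => ?_⟩
    have hnδ : 1 / ((n : ℝ) + 1) < δ / 3 :=
      (Nat.one_div_le_one_div (le_trans (le_max_right _ _) hn)).trans_lt hN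
    obtain ⟨y, hy, hjy⟩ := happ n (denseSeq A j) (by
      have : j < n + 1 := Nat.lt_succ_of_le (le_trans (le_max_left _ _) hn)
      simp only [Finset.coe_union, Finset.coe_image, Finset.coe_range]
      exact Or.inr ⟨j, this, rfl⟩)
    rw [← hRcoe n] at hy
    have h1 : Metric.infDist a (R n : Set A) ≤ dist a y := Metric.infDist_le_dist_of_mem hy
    have h2 := dist_triangle a (denseSeq A j) y
    rw [dist_eq_norm (denseSeq A j)] at h2
    rw [Metric.mem_ball, dist_comm] at hj
    rw [dist_comm]
    linarith [hab n]
  obtain ⟨N, hN⟩ := exists_nat_one_div_lt hε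
  obtain ⟨n, ⟨ψ, hψ⟩, hn⟩ :=
    ((hC.eventually_lift hR happrox φ F hε).and (eventually_ge_atTop N)).exists
  let e : Cfam (i n) ≃⋆ₐ[ℂ] R n := StarAlgEquiv.ofInjective' (ι n) (hinj n)
  have he : ∀ z : R n, ι n (e.symm z) = z := fun z =>
    congrArg Subtype.val (e.apply_symm_apply z)
  refine ⟨i n, ι n, (e.symm : R n →⋆ₙₐ[ℂ] Cfam (i n)).comp ψ, hinj n, fun x hx => ?_,
    fun x hx => ?_⟩
  · obtain ⟨y, hy, hxy⟩ := happ n x (by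
      rw [Finset.coe_union]
      exact Or.inl hx)
    exact ⟨y, hy, hxy.trans ((Nat.one_div_le_one_div hn).trans_lt hN)⟩
  · have := hψ x hx
    rwa [← he (ψ x)] at this

end WeaklySemiprojective

section ApproximateIntertwining

/-- One-sided approximate intertwining: isometric embeddings of the terms of an inductive system
into `A` which asymptotically commute with the connecting maps exhibit `A` as the limit. -/
theorem exists_isInductiveLimit_of_approx_s6 {X : ℕ → Type u} [∀ k, NonUnitalCStarAlgebra (X k)]
    {A : Type u} [NonUnitalCStarAlgebra A] (γ : ∀ k, X k →⋆ₙₐ[ℂ] X (k + 1))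
    (φ : ∀ k, X k →⋆ₙₐ[ℂ] A) (hφ : ∀ k, Function.Injective (φ k))
    (S : ∀ k, ℕ → Set (X k)) (hSmono : ∀ k, Monotone (S k))
    (hSdense : ∀ k, Dense (⋃ n, S k n)) (hSγ : ∀ k n, ∀ x ∈ S k n, γ k x ∈ S (k + 1) n)
    (hclose : ∀ k, ∀ x ∈ S k k, ‖φ (k + 1) (γ k x) - φ k x‖ ≤ (1 / 2) ^ k)
    (hA : ∀ (a : A) (ε : ℝ), 0 < ε → ∀ N, ∃ k ≥ N, ∃ x ∈ S k k, ‖a - φ k x‖ < ε) :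
    ∃ μ : ∀ k, X k →⋆ₙₐ[ℂ] A, IsInductiveLimit γ A μ := by
  have hiter : ∀ k m n, ∀ x ∈ S k m, iterHom γ k n x ∈ S (k + n) m := by
    intro k m n x hx
    induction n with
    | zero => exact hx
    | succ n ih => exact hSγ _ _ _ ih
  let s : ∀ k, X k → ℕ → A := fun k x n => φ (k + n) (iterHom γ k n x)
  have hstep : ∀ k m, ∀ x ∈ S k m, ∀ n, m ≤ k + n →
      dist (s k x n) (s k x (n + 1)) ≤ (1 / 2) ^ (k + n) := by
    intro k m x hx n hn
    rw [dist_comm, dist_eq_norm]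
    exact hclose (k + n) _ (hSmono _ hn (hiter k m n x hx))
  have hcontr : ∀ k x y n, dist (s k x n) (s k y n) ≤ dist x y := by
    intro k x y n
    have h1 : s k x n - s k y n = φ (k + n) (iterHom γ k n (x - y)) := by
      simp only [s, map_sub]
    rw [dist_eq_norm, dist_eq_norm, h1]
    exact (NonUnitalStarAlgHom.norm_apply_le _ _).trans (NonUnitalStarAlgHom.norm_apply_le _ _)
  have hcauchyS : ∀ k m, ∀ x ∈ S k m, CauchySeq (s k x) := by
    intro k m x hx
    have : CauchySeq fun n => s k x (n + m) := by
      refine cauchySeq_of_le_geometric (1 / 2) 1 (by norm_num) fun n => ?_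
      have h1 := hstep k m x hx (n + m) (by omega)
      rw [add_right_comm n m 1] at h1
      refine h1.trans ?_
      rw [one_mul]
      exact pow_le_pow_of_le_one (by norm_num) (by norm_num) (by omega)
    exact (cauchySeq_shift m).1 this
  have hcauchy : ∀ k x, CauchySeq (s k x) := by
    intro k x
    refine Metric.cauchySeq_iff'.2 fun ε hε => ?_
    obtain ⟨y, hy, hyS⟩ := Metric.dense_iff.1 (hSdense k) x (ε / 3) (by positivity)
    obtain ⟨m, hm⟩ := mem_iUnion.1 hyS
    obtain ⟨N, hN⟩ := Metric.cauchySeq_iff'.1 (hcauchyS k m y hm) (ε / 3) (by positivity)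
    refine ⟨N, fun n hn => ?_⟩
    have h1 := hcontr k x y n
    have h2 := hcontr k y x N
    have h3 := hN n hn
    have h4 := dist_triangle4 (s k x n) (s k y n) (s k y N) (s k x N)
    rw [Metric.mem_ball] at hy
    rw [dist_comm] at h1
    rw [dist_comm x y, dist_comm (s k y n)] at h1
    linarith
  choose lim hlim using fun k x => cauchySeq_tendsto_of_complete (hcauchy k x)
  let μ : ∀ k, X k →⋆ₙₐ[ℂ] A := fun k =>
    { toFun := lim k
      map_smul' := fun c x => tendsto_nhds_unique (hlim k (c • x)) <| by
        simpa only [s, map_smul, MonoidHom.id_apply] using (hlim k x).const_smul c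
      map_zero' := tendsto_nhds_unique (hlim k 0) <| by
        simpa only [s, map_zero] using tendsto_const_nhds
      map_add' := fun x y => tendsto_nhds_unique (hlim k (x + y)) <| by
        simpa only [s, map_add] using (hlim k x).add (hlim k y)
      map_mul' := fun x y => tendsto_nhds_unique (hlim k (x * y)) <| by
        simpa only [s, map_mul] using (hlim k x).mul (hlim k y)
      map_star' := fun x => tendsto_nhds_unique (hlim k (star x)) <| by
        simpa only [s, map_star] using (hlim k x).star }
  have hsucc : ∀ k x n, s (k + 1) (γ k x) n = s k x (n + 1) := by
    have key : ∀ k x n, HEq (iterHom γ (k + 1) n (γ k x)) (iterHom γ k (n + 1) x) := by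
      intro k x n
      induction n with
      | zero => rfl
      | succ n ih =>
        have hidx : k + 1 + n = k + (n + 1) := by omega
        change HEq (γ (k + 1 + n) (iterHom γ (k + 1) n (γ k x)))
          (γ (k + (n + 1)) (iterHom γ k (n + 1) x))
        revert ih
        generalize iterHom γ (k + 1) n (γ k x) = p
        generalize iterHom γ k (n + 1) x = q
        revert p q
        rw [hidx]
        intro p q hpq
        rw [eq_of_heq hpq]
    intro k x n
    have hidx : k + 1 + n = k + (n + 1) := by omega
    have := key k x n
    revert this
    change HEq _ _ → φ (k + 1 + n) (iterHom γ (k + 1) n (γ k x)) =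
      φ (k + (n + 1)) (iterHom γ k (n + 1) x)
    generalize iterHom γ (k + 1) n (γ k x) = p
    generalize iterHom γ k (n + 1) x = q
    revert p q
    rw [hidx]
    intro p q hpq
    rw [eq_of_heq hpq]
  refine ⟨μ, fun k => ?_, ?_, fun k x => ?_⟩
  · ext x
    refine tendsto_nhds_unique (hlim (k + 1) (γ k x)) ?_
    rw [funext (hsucc k x)]
    exact (hlim k x).comp (tendsto_add_atTop_nat 1)
  · refine Metric.dense_iff.2 fun a ε hε => ?_
    obtain ⟨N, hN⟩ := exists_pow_lt_of_lt_one (show (0 : ℝ) < ε / 4 by positivity)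
      (show (1 / 2 : ℝ) < 1 by norm_num)
    obtain ⟨k, hk, x, hx, hax⟩ := hA a (ε / 2) (half_pos hε) N
    refine ⟨μ k x, ?_, mem_iUnion.2 ⟨k, x, rfl⟩⟩
    have h1 : dist (s k x 0) (lim k x) ≤ (1 / 2) ^ k / (1 - 1 / 2) := by
      refine dist_le_of_le_geometric_of_tendsto₀ (1 / 2) ((1 / 2) ^ k) (by norm_num) (fun n => ?_)
        (hlim k x)
      rw [← pow_add]
      exact hstep k k x hx n (by omega)
    have h2 : (1 / 2 : ℝ) ^ k ≤ (1 / 2) ^ N := pow_le_pow_of_le_one (by norm_num) (by norm_num) hk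
    have h3 : dist a (s k x 0) < ε / 2 := by
      rw [dist_eq_norm]
      exact hax
    have h4 := dist_triangle a (s k x 0) (lim k x)
    rw [Metric.mem_ball, dist_comm]
    change dist a (lim k x) < ε
    have h5 : (1 / 2 : ℝ) ^ k / (1 - 1 / 2) = 2 * (1 / 2) ^ k := by ring
    linarith
  · change Tendsto _ _ (𝓝 ‖lim k x‖)
    have := (hlim k x).norm
    simpa only [s, NonUnitalStarAlgHom.norm_map _ (hφ _)] using this

end ApproximateIntertwining

section Construction

open TopologicalSpace

/-- A member of the family embedded in `A`, together with an increasing sequence of finite subsets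
with dense union. -/
structure EmbeddedMember {I : Type v} (Cfam : I → Type u) [∀ i, NonUnitalCStarAlgebra (Cfam i)]
    (A : Type u) [NonUnitalCStarAlgebra A] where
  idx : I
  emb : Cfam idx →⋆ₙₐ[ℂ] A
  injective : Function.Injective emb
  sets : ℕ → Finset (Cfam idx)
  mono : Monotone sets
  dense : Dense (⋃ n, (sets n : Set (Cfam idx)))

variable {I : Type v} {Cfam : I → Type u} [∀ i, NonUnitalCStarAlgebra (Cfam i)]
  {A : Type u} [NonUnitalCStarAlgebra A] [SeparableSpace A]

/-- Any increasing sequence of finite subsets of an embedded member can be enlarged to one with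
dense union. -/
theorem EmbeddedMember.exists_of_injective (i : I) (ι : Cfam i →⋆ₙₐ[ℂ] A)
    (hι : Function.Injective ι) (T : ℕ → Finset (Cfam i)) (hT : Monotone T) :
    ∃ S : ℕ → Finset (Cfam i), Monotone S ∧ (∀ n, T n ⊆ S n) ∧
      Dense (⋃ n, (S n : Set (Cfam i))) := by
  classical
  have : SecondCountableTopology A := UniformSpace.secondCountable_of_separable A
  have : SecondCountableTopology (Cfam i) :=
    (NonUnitalStarAlgHom.isometry ι hι).isEmbedding.secondCountableTopology
  refine ⟨fun n => T n ∪ (Finset.range (n + 1)).image (denseSeq (Cfam i)), ?_,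
    fun n => Finset.subset_union_left, ?_⟩
  · intro m n hmn
    exact Finset.union_subset_union (hT hmn)
      (Finset.image_subset_image (Finset.range_subset_range.2 (by omega)))
  · refine (denseRange_denseSeq (Cfam i)).mono ?_
    rintro _ ⟨n, rfl⟩
    refine mem_iUnion.2 ⟨n, Finset.mem_coe.2 (Finset.mem_union_right _ ?_)⟩
    exact Finset.mem_image_of_mem _ (Finset.self_mem_range_succ n)

theorem EmbeddedMember.exists_next (hwsp : ∀ i, IsWeaklySemiprojective (Cfam i))
    (h : ∀ (F : Finset A) (ε : ℝ), 0 < ε → ∃ (i : I) (ι : Cfam i →⋆ₙₐ[ℂ] A),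
      Function.Injective ι ∧ EpsContained ε ↑F (Set.range ι))
    (s : EmbeddedMember Cfam A) (F : Finset (Cfam s.idx)) (G : Finset A) {ε : ℝ} (hε : 0 < ε) :
    ∃ (t : EmbeddedMember Cfam A) (γ : Cfam s.idx →⋆ₙₐ[ℂ] Cfam t.idx),
      (∀ x ∈ F, ‖t.emb (γ x) - s.emb x‖ < ε) ∧ (∀ n, ∀ x ∈ s.sets n, γ x ∈ t.sets n) ∧
      ∀ a ∈ G, ∃ y ∈ t.sets 0, ‖a - t.emb y‖ < ε := by
  classical
  obtain ⟨i, ι, γ, hι, hG, hF⟩ := (hwsp s.idx).exists_approx_factor h s.emb F G hε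
  have hsel : ∀ a : A, ∃ y : Cfam i, a ∈ G → ‖a - ι y‖ < ε := by
    intro a
    by_cases ha : a ∈ G
    · obtain ⟨_, ⟨y, rfl⟩, hy⟩ := hG a ha
      exact ⟨y, fun _ => hy⟩
    · exact ⟨0, fun h' => absurd h' ha⟩
  choose y hy using hsel
  obtain ⟨S, hSmono, hTS, hSdense⟩ := EmbeddedMember.exists_of_injective i ι hι
    (fun n => (s.sets n).image γ ∪ G.image y)
    (fun m n hmn => Finset.union_subset_union_left (Finset.image_subset_image (s.mono hmn)))
  exact ⟨⟨i, ι, hι, S, hSmono, hSdense⟩, γ, hF,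
    fun n x hx => hTS n (Finset.mem_union_left _ (Finset.mem_image_of_mem _ hx)),
    fun a ha => ⟨y a, hTS 0 (Finset.mem_union_right _ (Finset.mem_image_of_mem _ ha)), hy a ha⟩⟩

end Construction

end

open TopologicalSpace in
/-- Loring's local test for inductive limits: if a separable C*-algebra `A` is approximated
by sub-C*-algebras isomorphic to members of a family `(C_i)` of weakly semiprojective
C*-algebras, then `A` is an inductive limit of algebras from the family. -/
theorem CLike_implies_AC
    {I : Type v} (Cfam : I → Type u) [∀ i, NonUnitalCStarAlgebra (Cfam i)]
    (hwsp : ∀ i, IsWeaklySemiprojective (Cfam i))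
    (A : Type u) [NonUnitalCStarAlgebra A] [SeparableSpace A]
    (h : ∀ (F : Finset A) (ε : ℝ), 0 < ε →
      ∃ (B : Type u) (_ : NonUnitalCStarAlgebra B) (ι : B →⋆ₙₐ[ℂ] A),
        Function.Injective ι ∧ EpsContained ε ↑F (Set.range ι) ∧
        ∃ i : I, Nonempty (B ≃⋆ₐ[ℂ] Cfam i)) :
    ∃ (idx : ℕ → I) (γ : ∀ k, Cfam (idx k) →⋆ₙₐ[ℂ] Cfam (idx (k + 1)))
      (μ : ∀ k, Cfam (idx k) →⋆ₙₐ[ℂ] A), IsInductiveLimit γ A μ := by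
  classical
  have h' : ∀ (F : Finset A) (ε : ℝ), 0 < ε → ∃ (i : I) (ι : Cfam i →⋆ₙₐ[ℂ] A),
      Function.Injective ι ∧ EpsContained ε ↑F (Set.range ι) := by
    intro F ε hε
    obtain ⟨B, _, ι, hι, hF, i, ⟨e⟩⟩ := h F ε hε
    refine ⟨i, ι.comp (e.symm : Cfam i →⋆ₙₐ[ℂ] B), hι.comp e.symm.injective, fun x hx => ?_⟩
    obtain ⟨_, ⟨b, rfl⟩, hb⟩ := hF x hx
    exact ⟨ι b, ⟨e b, congrArg ι (e.symm_apply_apply b)⟩, hb⟩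
  obtain ⟨i₀, ι₀, hι₀, -⟩ := h' ∅ 1 one_pos
  obtain ⟨S₀, hS₀mono, -, hS₀dense⟩ :=
    EmbeddedMember.exists_of_injective i₀ ι₀ hι₀ (fun _ => ∅) monotone_const
  choose next γ hγclose hγsets hγapprox using fun (k : ℕ) (s : EmbeddedMember Cfam A) =>
    EmbeddedMember.exists_next hwsp h' s (s.sets k)
      ((Finset.range (k + 1)).image (denseSeq A)) (show (0 : ℝ) < (1 / 2) ^ k by positivity)
  let s : ℕ → EmbeddedMember Cfam A := fun k =>
    Nat.rec ⟨i₀, ι₀, hι₀, S₀, hS₀mono, hS₀dense⟩ (fun k t => next k t) k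
  obtain ⟨μ, hμ⟩ := exists_isInductiveLimit_of_approx_s6 (X := fun k => Cfam (s k).idx)
    (fun k => γ k (s k)) (fun k => (s k).emb) (fun k => (s k).injective)
    (fun k n => ((s k).sets n : Set (Cfam (s k).idx))) (fun k m n hmn => (s k).mono hmn)
    (fun k => (s k).dense) (fun k n x hx => hγsets k (s k) n x hx)
    (fun k x hx => (hγclose k (s k) x hx).le) (by
      intro a ε hε N
      obtain ⟨_, ha, ⟨j, rfl⟩⟩ :=
        Metric.dense_iff.1 (denseRange_denseSeq A) a (ε / 2) (half_pos hε)
      obtain ⟨M, hM⟩ := exists_pow_lt_of_lt_one (half_pos hε) (show (1 / 2 : ℝ) < 1 by norm_num)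
      let k := max N (max j M)
      have hjk : j ≤ k := (le_max_left j M).trans (le_max_right N _)
      have hMk : M ≤ k := (le_max_right j M).trans (le_max_right N _)
      have hNk : N ≤ k := le_max_left N _
      obtain ⟨y, hy, hjy⟩ := hγapprox k (s k) (denseSeq A j)
        (Finset.mem_image_of_mem _ (Finset.mem_range.2 (Nat.lt_succ_of_le hjk)))
      refine ⟨k + 1, by omega, y, (s (k + 1)).mono (Nat.zero_le _) hy, ?_⟩
      have h1 : (1 / 2 : ℝ) ^ k ≤ (1 / 2) ^ M :=
        pow_le_pow_of_le_one (by norm_num) (by norm_num) hMk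
      rw [Metric.mem_ball, dist_comm, dist_eq_norm] at ha
      have h2 := norm_sub_le_norm_sub_add_norm_sub a (denseSeq A j) ((s (k + 1)).emb y)
      have h3 : ‖denseSeq A j - (s (k + 1)).emb y‖ < (1 / 2) ^ k := hjy
      linarith)
  exact ⟨fun k => (s k).idx, fun k => γ k (s k), μ, hμ⟩
end
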